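/- arXiv:1803.10430 — 3 statements merged into one kernel-verified Lean document; each statement's English description precedes it below -/
import Mathlib

section
/- Real interpolation of weighted sequence spaces: for $s_0\neq s_1$ real, $0<\theta<1$ and $1\leq q_0,q_1,q\leq\infty$, one has $(\ell^{s_0}_{q_0},\ell^{s_1}_{q_1})_{\theta,q}=\ell^{s}_q$ with equivalent norms, where $s=(1-\theta)s_0+\theta s_1$. -/
open MeasureTheory Set
open scoped ENNReal

noncomputable section

variable {E : Type*} [AddCommGroup E]

/-- Peetre's `K`-functional for a couple of (extended-valued) norms on an ambient group. -/
def Kfun (N0 N1 : E → ℝ≥0∞) (t : ℝ) (a : E) : ℝ≥0∞ :=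
  ⨅ (d : E × E) (_ : d.1 + d.2 = a), N0 d.1 + ENNReal.ofReal t * N1 d.2

/-- The real interpolation norm `‖a‖_{(A₀,A₁)_{θ,q}}` defined via the `K`-functional. -/
def interpNorm (N0 N1 : E → ℝ≥0∞) (θ : ℝ) (q : ℝ≥0∞) (a : E) : ℝ≥0∞ :=
  if q = ⊤ then ⨆ (t : ℝ) (_ : 0 < t), ENNReal.ofReal (t ^ (-θ)) * Kfun N0 N1 t a
  else
    (∫⁻ t in Ioi (0 : ℝ),
        (ENNReal.ofReal (t ^ (-θ)) * Kfun N0 N1 t a) ^ q.toReal / ENNReal.ofReal t) ^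
      (1 / q.toReal)

/-- The weighted sequence norm `‖(x_j)‖_{ℓ^s_q}` with weights `2^{js}`. -/
def seqNorm (s : ℝ) (q : ℝ≥0∞) (x : ℕ → ℝ) : ℝ≥0∞ :=
  if q = ⊤ then ⨆ j : ℕ, ENNReal.ofReal ((2 : ℝ) ^ ((j : ℝ) * s)) * (‖x j‖₊ : ℝ≥0∞)
  else
    (∑' j : ℕ, (ENNReal.ofReal ((2 : ℝ) ^ ((j : ℝ) * s)) * (‖x j‖₊ : ℝ≥0∞)) ^ q.toReal) ^
      (1 / q.toReal)

namespace RIW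

lemma coord_le (s : ℝ) (q : ℝ≥0∞) (hq : 1 ≤ q) (x : ℕ → ℝ) (j : ℕ) :
    ENNReal.ofReal ((2 : ℝ) ^ ((j : ℝ) * s)) * (‖x j‖₊ : ℝ≥0∞) ≤ seqNorm s q x := by
  unfold seqNorm
  split_ifs with h
  · exact le_iSup (fun j : ℕ => ENNReal.ofReal ((2 : ℝ) ^ ((j : ℝ) * s)) * (‖x j‖₊ : ℝ≥0∞)) j
  · have hp : 0 < q.toReal := ENNReal.toReal_pos (by positivity) h
    rw [one_div, ENNReal.le_rpow_inv_iff hp]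
    exact ENNReal.le_tsum (f := fun j : ℕ =>
      (ENNReal.ofReal ((2 : ℝ) ^ ((j : ℝ) * s)) * (‖x j‖₊ : ℝ≥0∞)) ^ q.toReal) j

lemma seqNorm_le (s : ℝ) (q : ℝ≥0∞) (hq : 1 ≤ q) (x : ℕ → ℝ) :
    seqNorm s q x ≤ ∑' j : ℕ, ENNReal.ofReal ((2 : ℝ) ^ ((j : ℝ) * s)) * (‖x j‖₊ : ℝ≥0∞) := by
  unfold seqNorm
  split_ifs with h
  · exact iSup_le fun j => ENNReal.le_tsum j
  · have hp1 : 1 ≤ q.toReal := by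
      rw [← ENNReal.toReal_one]; exact ENNReal.toReal_mono h hq
    have hp : 0 < q.toReal := by linarith
    set p := q.toReal
    rw [one_div, ENNReal.rpow_inv_le_iff hp]
    have key : ∀ y : ℝ≥0∞, y ^ p = y * y ^ (p - 1) := fun y => by
      conv_lhs => rw [show p = 1 + (p - 1) by ring,
        ENNReal.rpow_add_of_nonneg _ _ zero_le_one (by linarith), ENNReal.rpow_one]
    rw [key (∑' j, _), ← ENNReal.tsum_mul_right]
    refine ENNReal.tsum_le_tsum fun j => ?_
    rw [key]
    refine mul_le_mul_right (ENNReal.rpow_le_rpow ?_ (by linarith)) _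
    exact ENNReal.le_tsum (f := fun j : ℕ =>
      ENNReal.ofReal ((2 : ℝ) ^ ((j : ℝ) * s)) * (‖x j‖₊ : ℝ≥0∞)) j

/-- kernel -/
def M (θ u : ℝ) : ℝ≥0∞ := ENNReal.ofReal (min (u ^ (-θ)) (u ^ (1 - θ)))

lemma M_meas (θ : ℝ) : Measurable (M θ) := by
  unfold M
  fun_prop

lemma disj (w T : ℝ) (hT : 0 < T) : Pairwise (Function.onFun Disjoint fun j : ℕ =>
    Ico (T * 2 ^ ((j : ℝ) * w)) (T * 2 ^ ((j : ℝ) * w) * 2 ^ |w|)) := by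
  have main : ∀ i j : ℕ, i < j → Disjoint
      (Ico (T * (2:ℝ) ^ ((i : ℝ) * w)) (T * 2 ^ ((i : ℝ) * w) * 2 ^ |w|))
      (Ico (T * (2:ℝ) ^ ((j : ℝ) * w)) (T * 2 ^ ((j : ℝ) * w) * 2 ^ |w|)) := by
    intro i j hij
    have hij' : (i : ℝ) + 1 ≤ j := by exact_mod_cast hij
    rw [Set.disjoint_left]
    rintro v ⟨h1, h2⟩ ⟨h3, h4⟩
    rw [mul_assoc, ← Real.rpow_add two_pos] at h2 h4
    rcases le_total 0 w with hw | hw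
    · rw [abs_of_nonneg hw] at h2
      have : (2:ℝ) ^ ((i : ℝ) * w + w) ≤ 2 ^ ((j : ℝ) * w) :=
        Real.rpow_le_rpow_of_exponent_le one_le_two (by nlinarith)
      have := mul_le_mul_of_nonneg_left this hT.le
      linarith
    · rw [abs_of_nonpos hw] at h4
      have : (2:ℝ) ^ ((j : ℝ) * w + -w) ≤ 2 ^ ((i : ℝ) * w) :=
        Real.rpow_le_rpow_of_exponent_le one_le_two (by nlinarith)
      have := mul_le_mul_of_nonneg_left this hT.le
      linarith
  intro i j hij
  rcases lt_or_gt_of_ne hij with h | h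
  · exact main i j h
  · exact (main j i h).symm

/-- comparison constant -/
def D (w : ℝ) : ℝ := (2 ^ |w| - 1) / 2 ^ |w|

lemma D_pos (w : ℝ) (hw : w ≠ 0) : 0 < D w := by
  unfold D
  have : (1:ℝ) < 2 ^ |w| := Real.one_lt_rpow one_lt_two (abs_pos.2 hw)
  apply div_pos <;> linarith

lemma sum_le_int (w T : ℝ) (hT : 0 < T) (g : ℝ → ℝ≥0∞) (A : ℕ → ℝ≥0∞)
    (h : ∀ j : ℕ, ∀ v ∈ Ico (T * 2 ^ ((j : ℝ) * w)) (T * 2 ^ ((j : ℝ) * w) * 2 ^ |w|),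
      A j / ENNReal.ofReal v ≤ g v) :
    ENNReal.ofReal (D w) * ∑' j, A j ≤ ∫⁻ v in Ioi (0 : ℝ), g v := by
  have hsub : (⋃ j : ℕ, Ico (T * (2:ℝ) ^ ((j : ℝ) * w)) (T * 2 ^ ((j : ℝ) * w) * 2 ^ |w|)) ⊆
      Ioi 0 := by
    refine iUnion_subset fun j v hv => ?_
    exact lt_of_lt_of_le (by positivity) hv.1
  refine le_trans ?_ (lintegral_mono_set hsub)
  rw [lintegral_iUnion (fun j => measurableSet_Ico) (disj w T hT), ← ENNReal.tsum_mul_left]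
  refine ENNReal.tsum_le_tsum fun j => ?_
  set a : ℝ := T * (2:ℝ) ^ ((j : ℝ) * w) with ha
  have ha0 : 0 < a := by positivity
  set r : ℝ := 2 ^ |w| with hr
  have hr0 : 0 < r := by positivity
  calc ENNReal.ofReal (D w) * A j
      = ∫⁻ v in Ico a (a * r), A j / ENNReal.ofReal (a * r) := by
        rw [setLIntegral_const, Real.volume_Ico, div_eq_mul_inv, mul_assoc, mul_comm]
        congr 1
        rw [← ENNReal.ofReal_inv_of_pos (by positivity), ← ENNReal.ofReal_mul (by positivity)]
        congr 1
        unfold D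
        rw [← hr]
        field_simp
    _ ≤ ∫⁻ v in Ico a (a * r), g v := by
        refine setLIntegral_mono' measurableSet_Ico fun v hv => le_trans ?_ (h j v hv)
        gcongr
        exact hv.2.le

lemma J_lt (θ : ℝ) (hθ : 0 < θ) (hθ1 : θ < 1) :
    ∫⁻ v in Ioi (0 : ℝ), M θ v / ENNReal.ofReal v < ⊤ := by
  have hu : Ioi (0:ℝ) = Ioc 0 1 ∪ Ioi 1 := by
    rw [Ioc_union_Ioi_eq_Ioi zero_le_one]
  rw [hu]
  refine (lintegral_union_le _ _ _).trans_lt (ENNReal.add_lt_top.2 ⟨?_, ?_⟩)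
  · have h1 : IntegrableOn (fun v : ℝ => v ^ (-θ)) (Ioc 0 1) := by
      rw [← intervalIntegrable_iff_integrableOn_Ioc_of_le zero_le_one]
      exact intervalIntegral.intervalIntegrable_rpow' (by linarith)
    refine lt_of_le_of_lt (setLIntegral_mono' measurableSet_Ioc fun v hv => ?_) h1.2
    rw [M, ← ENNReal.ofReal_div_of_pos hv.1, ← ofReal_norm]
    apply ENNReal.ofReal_le_ofReal
    rw [Real.norm_of_nonneg (Real.rpow_nonneg hv.1.le _), div_le_iff₀ hv.1]
    refine (min_le_right _ _).trans (le_of_eq ?_)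
    rw [← Real.rpow_add_one hv.1.ne']; congr 1; ring
  · have h1 : IntegrableOn (fun v : ℝ => v ^ (-θ - 1)) (Ioi 1) :=
      integrableOn_Ioi_rpow_of_lt (by linarith) zero_lt_one
    refine lt_of_le_of_lt (setLIntegral_mono' measurableSet_Ioi fun v hv => ?_) h1.2
    have hv0 : 0 < v := lt_trans zero_lt_one hv
    rw [M, ← ENNReal.ofReal_div_of_pos hv0, ← ofReal_norm]
    apply ENNReal.ofReal_le_ofReal
    rw [Real.norm_of_nonneg (Real.rpow_nonneg hv0.le _), div_le_iff₀ hv0]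
    refine (min_le_left _ _).trans (le_of_eq ?_)
    rw [← Real.rpow_add_one hv0.ne']; congr 1; ring

lemma scale (c : ℝ) (hc : 0 < c) (f : ℝ → ℝ≥0∞) :
    ∫⁻ t in Ioi (0 : ℝ), f (c * t) / ENNReal.ofReal t =
      ∫⁻ v in Ioi (0 : ℝ), f v / ENNReal.ofReal v := by
  have him : (fun t => c * t) '' Ioi (0:ℝ) = Ioi 0 := by
    have := Set.image_mul_left_Ioi hc 0
    rwa [mul_zero] at this
  have := lintegral_image_eq_lintegral_abs_deriv_mul (s := Ioi (0:ℝ)) (f := fun t => c * t)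
    (f' := fun _ => c) measurableSet_Ioi
    (fun x _ => by simpa using ((hasDerivAt_id x).const_mul c).hasDerivWithinAt)
    (mul_right_injective₀ hc.ne').injOn (fun v => f v / ENNReal.ofReal v)
  rw [him] at this
  rw [this]
  refine setLIntegral_congr_fun measurableSet_Ioi fun t ht => ?_
  have ht : 0 < t := ht
  rw [abs_of_pos hc, ENNReal.ofReal_mul hc.le, div_eq_mul_inv, div_eq_mul_inv,
    ENNReal.mul_inv (Or.inr ENNReal.ofReal_ne_top) (Or.inl ENNReal.ofReal_ne_top)]
  rw [mul_left_comm, ← mul_assoc (ENNReal.ofReal c), ENNReal.mul_inv_cancel, one_mul]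
  · simpa using hc
  · exact ENNReal.ofReal_ne_top

lemma M_low (θ : ℝ) (hθ : 0 < θ) (hθ1 : θ < 1) (u v r : ℝ) (hu : 0 < u) (hr : 1 ≤ r)
    (h1 : u ≤ v) (h2 : v ≤ u * r) :
    ENNReal.ofReal (r ^ (-θ)) * M θ u ≤ M θ v := by
  unfold M
  have hr0 : 0 < r := by linarith
  have hr1 : r ^ (-θ) ≤ 1 := Real.rpow_le_one_of_one_le_of_nonpos hr (by linarith)
  rw [← ENNReal.ofReal_mul (by positivity)]
  apply ENNReal.ofReal_le_ofReal
  rw [mul_min_of_nonneg _ _ (by positivity)]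
  apply min_le_min
  · rw [← Real.mul_rpow hr0.le hu.le]
    exact Real.rpow_le_rpow_of_nonpos (by linarith) (by linarith) (by linarith)
  · calc r ^ (-θ) * u ^ (1 - θ) ≤ 1 * u ^ (1 - θ) := by gcongr
      _ ≤ v ^ (1 - θ) := by
        rw [one_mul]; exact Real.rpow_le_rpow hu.le h1 (by linarith)

/-- the constant bounding sums of the kernel -/
lemma sum_bound (θ : ℝ) (hθ : 0 < θ) (hθ1 : θ < 1) (w : ℝ) (hw : w ≠ 0) :
    ∃ B : ℝ≥0∞, B ≠ ⊤ ∧ ∀ t : ℝ, 0 < t → ∑' j : ℕ, M θ (t * 2 ^ ((j : ℝ) * w)) ≤ B := by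
  set r : ℝ := 2 ^ |w| with hr
  have hr1 : 1 ≤ r := Real.one_le_rpow one_le_two (abs_nonneg _)
  have hr0 : 0 < r := by linarith
  set k : ℝ≥0∞ := ENNReal.ofReal (D w) * ENNReal.ofReal (r ^ (-θ)) with hk
  have hk0 : k ≠ 0 := by
    have := D_pos w hw
    have h2 : 0 < r ^ (-θ) := by positivity
    simp [hk, this, h2]
  have hkt : k ≠ ⊤ := ENNReal.mul_ne_top ENNReal.ofReal_ne_top ENNReal.ofReal_ne_top
  refine ⟨(∫⁻ v in Ioi (0 : ℝ), M θ v / ENNReal.ofReal v) / k,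
    ENNReal.div_ne_top (J_lt θ hθ hθ1).ne hk0, fun t ht => ?_⟩
  rw [ENNReal.le_div_iff_mul_le (Or.inl hk0) (Or.inl hkt), mul_comm, hk, mul_assoc,
    ← ENNReal.tsum_mul_left]
  refine sum_le_int w t ht _ _ fun j v hv => ?_
  gcongr
  exact M_low θ hθ hθ1 _ _ _ (by positivity) hr1 hv.1 hv.2.le

lemma kernel_eq (s0 s1 θ t : ℝ) (ht : 0 < t) (j : ℕ) :
    ENNReal.ofReal (t ^ (-θ)) * min (ENNReal.ofReal (2 ^ ((j : ℝ) * s0)))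
      (ENNReal.ofReal t * ENNReal.ofReal (2 ^ ((j : ℝ) * s1))) =
    ENNReal.ofReal (2 ^ ((j : ℝ) * ((1 - θ) * s0 + θ * s1))) *
      M θ (t * 2 ^ ((j : ℝ) * (s1 - s0))) := by
  unfold M
  rw [← ENNReal.ofReal_mul ht.le, ← ENNReal.ofReal_min, ← ENNReal.ofReal_mul (by positivity),
    ← ENNReal.ofReal_mul (by positivity), mul_min_of_nonneg _ _ (by positivity),
    mul_min_of_nonneg _ _ (by positivity)]
  congr 2
  · rw [Real.mul_rpow ht.le (by positivity), ← Real.rpow_mul two_pos.le, mul_left_comm,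
      ← Real.rpow_add two_pos]
    congr 2; ring
  · rw [Real.mul_rpow ht.le (by positivity), ← Real.rpow_mul two_pos.le, ← mul_assoc,
      ← Real.rpow_add_one ht.ne', mul_left_comm, ← Real.rpow_add two_pos]
    congr 2 <;> ring

lemma K_low (s0 s1 : ℝ) (q0 q1 : ℝ≥0∞) (hq0 : 1 ≤ q0) (hq1 : 1 ≤ q1) (t : ℝ) (x : ℕ → ℝ) (j : ℕ) :
    min (ENNReal.ofReal (2 ^ ((j : ℝ) * s0)))
      (ENNReal.ofReal t * ENNReal.ofReal (2 ^ ((j : ℝ) * s1))) * (‖x j‖₊ : ℝ≥0∞) ≤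
    Kfun (seqNorm s0 q0) (seqNorm s1 q1) t x := by
  unfold Kfun
  refine le_iInf₂ fun d hd => ?_
  have hx : (‖x j‖₊ : ℝ≥0∞) ≤ ‖d.1 j‖₊ + ‖d.2 j‖₊ := by
    rw [← hd]; exact_mod_cast nnnorm_add_le (d.1 j) (d.2 j)
  calc _ ≤ _ * ((‖d.1 j‖₊ : ℝ≥0∞) + ‖d.2 j‖₊) := by gcongr
    _ ≤ ENNReal.ofReal (2 ^ ((j : ℝ) * s0)) * ‖d.1 j‖₊ +
        (ENNReal.ofReal t * ENNReal.ofReal (2 ^ ((j : ℝ) * s1))) * ‖d.2 j‖₊ := by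
      rw [mul_add]
      gcongr
      · exact min_le_left _ _
      · exact min_le_right _ _
    _ ≤ _ := by
      rw [mul_assoc]
      gcongr
      · exact coord_le s0 q0 hq0 _ j
      · exact coord_le s1 q1 hq1 _ j

lemma K_up (s0 s1 : ℝ) (q0 q1 : ℝ≥0∞) (hq0 : 1 ≤ q0) (hq1 : 1 ≤ q1) (t : ℝ) (x : ℕ → ℝ) :
    Kfun (seqNorm s0 q0) (seqNorm s1 q1) t x ≤
    ∑' j : ℕ, min (ENNReal.ofReal (2 ^ ((j : ℝ) * s0)))
      (ENNReal.ofReal t * ENNReal.ofReal (2 ^ ((j : ℝ) * s1))) * (‖x j‖₊ : ℝ≥0∞) := by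
  classical
  let P : ℕ → Prop := fun j => ENNReal.ofReal (2 ^ ((j : ℝ) * s0)) ≤
    ENNReal.ofReal t * ENNReal.ofReal (2 ^ ((j : ℝ) * s1))
  let y : ℕ → ℝ := fun j => if P j then x j else 0
  let z : ℕ → ℝ := fun j => if P j then 0 else x j
  have hyz : y + z = x := by
    funext j
    by_cases h : P j <;> simp [y, z, h]
  unfold Kfun
  refine (iInf₂_le (y, z) hyz).trans ?_
  refine (add_le_add (seqNorm_le s0 q0 hq0 y)
    (mul_le_mul_right (seqNorm_le s1 q1 hq1 z) _)).trans ?_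
  rw [← ENNReal.tsum_mul_left, ← ENNReal.tsum_add]
  refine ENNReal.tsum_le_tsum fun j => ?_
  by_cases h : P j
  · simp only [y, z, h, if_true]
    rw [min_eq_left h]; simp
  · simp only [y, z, h, if_false]
    rw [min_eq_right (not_le.1 h).le]; simp [mul_assoc]

/-- weighted coordinates -/
def b (s : ℝ) (x : ℕ → ℝ) (j : ℕ) : ℝ≥0∞ :=
  ENNReal.ofReal ((2 : ℝ) ^ ((j : ℝ) * s)) * (‖x j‖₊ : ℝ≥0∞)

lemma tK_low (s0 s1 θ : ℝ) (q0 q1 : ℝ≥0∞) (hq0 : 1 ≤ q0) (hq1 : 1 ≤ q1) (t : ℝ) (ht : 0 < t)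
    (x : ℕ → ℝ) (j : ℕ) :
    b ((1 - θ) * s0 + θ * s1) x j * M θ (t * 2 ^ ((j : ℝ) * (s1 - s0))) ≤
    ENNReal.ofReal (t ^ (-θ)) * Kfun (seqNorm s0 q0) (seqNorm s1 q1) t x := by
  refine le_trans (le_of_eq ?_) (mul_le_mul_right (K_low s0 s1 q0 q1 hq0 hq1 t x j) _)
  rw [← mul_assoc, kernel_eq s0 s1 θ t ht, b, mul_right_comm]

lemma tK_up (s0 s1 θ : ℝ) (q0 q1 : ℝ≥0∞) (hq0 : 1 ≤ q0) (hq1 : 1 ≤ q1) (t : ℝ) (ht : 0 < t)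
    (x : ℕ → ℝ) :
    ENNReal.ofReal (t ^ (-θ)) * Kfun (seqNorm s0 q0) (seqNorm s1 q1) t x ≤
    ∑' j : ℕ, M θ (t * 2 ^ ((j : ℝ) * (s1 - s0))) * b ((1 - θ) * s0 + θ * s1) x j := by
  refine le_trans (mul_le_mul_right (K_up s0 s1 q0 q1 hq0 hq1 t x) _) (le_of_eq ?_)
  rw [← ENNReal.tsum_mul_left]
  refine tsum_congr fun j => ?_
  rw [← mul_assoc, kernel_eq s0 s1 θ t ht, b, mul_right_comm, mul_comm]

lemma jensen (p : ℝ) (hp : 1 ≤ p) (m c : ℕ → ℝ≥0∞) (B : ℝ≥0∞) (hB : ∑' j, m j ≤ B) :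
    (∑' j, m j * c j) ^ p ≤ B ^ (p - 1) * ∑' j, m j * c j ^ p := by
  have hp0 : 0 < p := by linarith
  have h : ∑' j, m j * c j ≤ B ^ (1 - p⁻¹) * (∑' j, m j * c j ^ p) ^ p⁻¹ := by
    rw [ENNReal.tsum_eq_iSup_sum]
    refine iSup_le fun s => (ENNReal.inner_le_weight_mul_Lp_of_nonneg s hp m c).trans ?_
    have : 0 ≤ 1 - p⁻¹ := by
      have := inv_le_one_of_one_le₀ hp
      linarith
    gcongr
    · exact (ENNReal.sum_le_tsum s).trans hB
    · exact ENNReal.sum_le_tsum s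
  refine (ENNReal.rpow_le_rpow h hp0.le).trans (le_of_eq ?_)
  rw [ENNReal.mul_rpow_of_nonneg _ _ hp0.le, ← ENNReal.rpow_mul, ← ENNReal.rpow_mul,
    inv_mul_cancel₀ hp0.ne', ENNReal.rpow_one]
  congr 2
  field_simp

lemma ex_const (k : ℝ≥0∞) (hk : k ≠ ⊤) : ∃ C > 0, k ≤ ENNReal.ofReal C :=
  ⟨k.toReal + 1, by positivity, by
    conv_lhs => rw [← ENNReal.ofReal_toReal hk]
    exact ENNReal.ofReal_le_ofReal (by linarith)⟩

lemma upper (s0 s1 : ℝ) (hs : s0 ≠ s1)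
    (θ : ℝ) (hθ : 0 < θ) (hθ1 : θ < 1) (q0 q1 q : ℝ≥0∞)
    (hq0 : 1 ≤ q0) (hq1 : 1 ≤ q1) (hq : 1 ≤ q) :
    ∃ k : ℝ≥0∞, k ≠ ⊤ ∧ ∀ x : ℕ → ℝ,
        interpNorm (seqNorm s0 q0) (seqNorm s1 q1) θ q x ≤
          k * seqNorm ((1 - θ) * s0 + θ * s1) q x := by
  obtain ⟨B, hB, hsum⟩ := sum_bound θ hθ hθ1 (s1 - s0) (sub_ne_zero.2 hs.symm)
  by_cases h : q = ⊤
  · refine ⟨B, hB, fun x => ?_⟩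
    unfold interpNorm
    rw [if_pos h]
    refine iSup₂_le fun t ht => (tK_up s0 s1 θ q0 q1 hq0 hq1 t ht x).trans ?_
    refine le_trans (ENNReal.tsum_le_tsum fun j =>
      mul_le_mul_right (coord_le _ q hq x j) _) ?_
    rw [ENNReal.tsum_mul_right]
    gcongr
    exact hsum t ht
  · have hp1 : 1 ≤ q.toReal := by
      rw [← ENNReal.toReal_one]; exact ENNReal.toReal_mono h hq
    have hp0 : 0 < q.toReal := by linarith
    set J := ∫⁻ v in Ioi (0 : ℝ), M θ v / ENNReal.ofReal v with hJ
    have hJt : J ≠ ⊤ := (J_lt θ hθ hθ1).ne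
    refine ⟨(B ^ (q.toReal - 1) * J) ^ (1 / q.toReal), ?_, fun x => ?_⟩
    · refine ENNReal.rpow_ne_top_of_nonneg (by positivity) (ENNReal.mul_ne_top ?_ hJt)
      exact ENNReal.rpow_ne_top_of_nonneg (by linarith) hB
    unfold interpNorm seqNorm
    rw [if_neg h, if_neg h]
    set p := q.toReal
    rw [← ENNReal.mul_rpow_of_nonneg _ _ (by positivity)]
    refine ENNReal.rpow_le_rpow ?_ (by positivity)
    set s := (1 - θ) * s0 + θ * s1 with hsdef
    calc _ ≤ ∫⁻ t in Ioi (0 : ℝ), B ^ (p - 1) * ∑' j : ℕ, b s x j ^ p *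
            (M θ ((2 ^ ((j : ℝ) * (s1 - s0))) * t) / ENNReal.ofReal t) := by
          refine setLIntegral_mono' measurableSet_Ioi fun t ht => ?_
          refine (ENNReal.div_le_div_right ((ENNReal.rpow_le_rpow
            (tK_up s0 s1 θ q0 q1 hq0 hq1 t ht x) hp0.le).trans
            (jensen p hp1 _ _ B (hsum t ht))) _).trans (le_of_eq ?_)
          rw [div_eq_mul_inv, mul_assoc, ← ENNReal.tsum_mul_right]
          congr 1
          refine tsum_congr fun j => ?_
          rw [mul_comm t, div_eq_mul_inv, mul_comm (M θ _), mul_assoc]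
      _ = B ^ (p - 1) * ∑' j : ℕ, b s x j ^ p * J := by
          have hm : ∀ j : ℕ, Measurable fun t : ℝ =>
              M θ ((2 ^ ((j : ℝ) * (s1 - s0))) * t) / ENNReal.ofReal t := fun j =>
            ((M_meas θ).comp (measurable_const_mul _)).div ENNReal.measurable_ofReal
          rw [lintegral_const_mul _ (Measurable.ennreal_tsum fun j => (hm j).const_mul _),
            lintegral_tsum fun j => ((hm j).const_mul _).aemeasurable]
          congr 1
          refine tsum_congr fun j => ?_
          rw [lintegral_const_mul _ (hm j), scale _ (by positivity) (M θ)]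
      _ = _ := by
          rw [ENNReal.tsum_mul_right, mul_assoc, mul_comm J]
          rfl

lemma M_one (θ : ℝ) : M θ 1 = 1 := by simp [M]

lemma lower (s0 s1 : ℝ) (hs : s0 ≠ s1)
    (θ : ℝ) (hθ : 0 < θ) (hθ1 : θ < 1) (q0 q1 q : ℝ≥0∞)
    (hq0 : 1 ≤ q0) (hq1 : 1 ≤ q1) (hq : 1 ≤ q) :
    ∃ c > 0, ∀ x : ℕ → ℝ,
      ENNReal.ofReal c * seqNorm ((1 - θ) * s0 + θ * s1) q x ≤
          interpNorm (seqNorm s0 q0) (seqNorm s1 q1) θ q x := by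
  have hcancel : ∀ j : ℕ, (2:ℝ) ^ ((j : ℝ) * (s0 - s1)) * 2 ^ ((j : ℝ) * (s1 - s0)) = 1 := by
    intro j
    rw [← Real.rpow_add two_pos, ← mul_add]; simp
  by_cases h : q = ⊤
  · refine ⟨1, one_pos, fun x => ?_⟩
    unfold interpNorm seqNorm
    rw [if_pos h, if_pos h, ENNReal.ofReal_one, one_mul]
    refine iSup_le fun j => ?_
    refine le_trans ?_ (le_iSup₂ (f := fun (t : ℝ) (_ : 0 < t) => ENNReal.ofReal (t ^ (-θ)) *
      Kfun (seqNorm s0 q0) (seqNorm s1 q1) t x) ((2:ℝ) ^ ((j : ℝ) * (s0 - s1))) (by positivity))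
    have := tK_low s0 s1 θ q0 q1 hq0 hq1 ((2:ℝ) ^ ((j : ℝ) * (s0 - s1))) (by positivity) x j
    rw [hcancel, M_one, mul_one] at this
    exact this
  · have hp1 : 1 ≤ q.toReal := by
      rw [← ENNReal.toReal_one]; exact ENNReal.toReal_mono h hq
    have hp0 : 0 < q.toReal := by linarith
    set p := q.toReal with hp
    have hD := D_pos (s0 - s1) (sub_ne_zero.2 hs)
    set r : ℝ := 2 ^ |s0 - s1| with hr
    have hr1 : 1 ≤ r := Real.one_le_rpow one_le_two (abs_nonneg _)
    have hr0 : 0 < r := by linarith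
    refine ⟨(D (s0 - s1)) ^ (1 / p) * r ^ (-θ), by positivity, fun x => ?_⟩
    unfold interpNorm seqNorm
    rw [if_neg h, if_neg h, ← hp]
    set s := (1 - θ) * s0 + θ * s1 with hsdef
    have key := sum_le_int (s0 - s1) 1 one_pos (fun t => (ENNReal.ofReal (t ^ (-θ)) *
      Kfun (seqNorm s0 q0) (seqNorm s1 q1) t x) ^ p / ENNReal.ofReal t)
      (fun j => (b s x j * ENNReal.ofReal (r ^ (-θ))) ^ p) (by
        intro j v hv
        rw [one_mul] at hv
        have hv0 : 0 < v := lt_of_lt_of_le (by positivity) hv.1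
        refine ENNReal.div_le_div_right (ENNReal.rpow_le_rpow ?_ hp0.le) _
        refine le_trans ?_ (tK_low s0 s1 θ q0 q1 hq0 hq1 v hv0 x j)
        refine mul_le_mul_right ?_ _
        have hpos : (0:ℝ) < 2 ^ ((j : ℝ) * (s1 - s0)) := by positivity
        have := M_low θ hθ hθ1 1 (v * 2 ^ ((j : ℝ) * (s1 - s0))) r one_pos hr1
          (by rw [← hcancel j]; gcongr; exact hv.1)
          (by
            rw [← hcancel j, mul_right_comm]; gcongr; exact hv.2.le)
        rwa [M_one, mul_one] at this)
    refine le_trans (le_of_eq ?_) (ENNReal.rpow_le_rpow key (by positivity : 0 ≤ 1 / p))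
    simp_rw [ENNReal.mul_rpow_of_nonneg _ _ hp0.le]
    rw [ENNReal.tsum_mul_right, ENNReal.mul_rpow_of_nonneg _ _ (by positivity : 0 ≤ 1 / p),
      ENNReal.mul_rpow_of_nonneg _ _ (by positivity : 0 ≤ 1 / p), ← ENNReal.rpow_mul,
      mul_one_div_cancel hp0.ne', ENNReal.rpow_one, ENNReal.ofReal_mul (by positivity),
      ENNReal.ofReal_rpow_of_pos hD, mul_assoc, mul_comm (ENNReal.ofReal (r ^ (-θ)))]
    rw [← tsum_congr fun j => ENNReal.mul_rpow_of_nonneg _ _ hp0.le]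
    rfl

end RIW

/-- real interpolation of weighted sequence spaces:
`(ℓ^{s₀}_{q₀}, ℓ^{s₁}_{q₁})_{θ,q} = ℓ^s_q`, `s = (1-θ)s₀ + θs₁`, with equivalent norms. -/
theorem real_interpolation_weighted_seq (s0 s1 : ℝ) (hs : s0 ≠ s1)
    (θ : ℝ) (hθ : 0 < θ) (hθ1 : θ < 1) (q0 q1 q : ℝ≥0∞)
    (hq0 : 1 ≤ q0) (hq1 : 1 ≤ q1) (hq : 1 ≤ q) :
    ∃ c > 0, ∃ C > 0, ∀ x : ℕ → ℝ,
      ENNReal.ofReal c * seqNorm ((1 - θ) * s0 + θ * s1) q x ≤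
          interpNorm (seqNorm s0 q0) (seqNorm s1 q1) θ q x ∧
        interpNorm (seqNorm s0 q0) (seqNorm s1 q1) θ q x ≤
          ENNReal.ofReal C * seqNorm ((1 - θ) * s0 + θ * s1) q x := by
  obtain ⟨c, hc, h1⟩ := RIW.lower s0 s1 hs θ hθ hθ1 q0 q1 q hq0 hq1 hq
  obtain ⟨k, hk, h2⟩ := RIW.upper s0 s1 hs θ hθ hθ1 q0 q1 q hq0 hq1 hq
  obtain ⟨C, hC, hkC⟩ := RIW.ex_const k hk
  exact ⟨c, hc, C, hC, fun x => ⟨h1 x, (h2 x).trans (mul_le_mul_left hkC _)⟩⟩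

end
end

section
/- Stationary phase bound: let $\eta\in C_c^\infty(\mathbb{R}^n)$ and $\varphi$ smooth on a neighborhood of $\mathrm{supp}\,\eta$ with Hessian $H\varphi$ of rank at least $k$ at every point of $\mathrm{supp}\,\eta$. Then there exists $C$ such that for all $(x,t)\in\mathbb{R}^{n+1}$, $\big|\int_{\mathbb{R}^n} e^{i(x\cdot\xi+t\varphi(\xi))}\eta(\xi)\,d\xi\big|\leq C(1+|(x,t)|)^{-k/2}$. -/
open MeasureTheory Set
open scoped ENNReal

noncomputable section

/-- The Hessian matrix `(∂²φ/∂ξᵢ∂ξⱼ)` of a function `φ : ℝⁿ → ℝ` at a point `ξ`. -/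
def hessianMatrix (n : ℕ) (φ : EuclideanSpace ℝ (Fin n) → ℝ)
    (ξ : EuclideanSpace ℝ (Fin n)) : Matrix (Fin n) (Fin n) ℝ :=
  Matrix.of fun i j =>
    fderiv ℝ (fun y => fderiv ℝ φ y (EuclideanSpace.single i (1 : ℝ))) ξ
      (EuclideanSpace.single j (1 : ℝ))
theorem sp_theta (c : ℝ) (hc : 0 < c) :
    ∃ θ : ℝ → ℝ, ContDiff ℝ (⊤ : ℕ∞) θ ∧ ∀ x, c ≤ x → θ x * x = 1 := by
  refine ⟨fun x => x / (x ^ 2 + Real.smoothTransition (1 - x / c)), ?_, ?_⟩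
  · refine ContDiff.div contDiff_id ?_ ?_
    · refine (contDiff_id.pow 2).add (Real.smoothTransition.contDiff.comp ?_)
      exact contDiff_const.sub (contDiff_id.div_const c)
    · intro x
      rcases lt_or_ge x c with h | h
      · have : 0 < Real.smoothTransition (1 - x / c) := by
          apply Real.smoothTransition.pos_of_pos
          rw [sub_pos, div_lt_one hc]; exact h
        positivity
      · have : 0 < x := hc.trans_le h
        have := Real.smoothTransition.nonneg (1 - x / c)
        positivity
  · intro x hx
    have h0 : 0 < x := hc.trans_le hx
    have : Real.smoothTransition (1 - x / c) = 0 := by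
      apply Real.smoothTransition.zero_of_nonpos
      rw [sub_nonpos, one_le_div hc]; exact hx
    simp only [this]
    field_simp
    simp

theorem sp_param_aux {X F : Type} [NormedAddCommGroup X] [NormedSpace ℝ X]
    [FiniteDimensional ℝ X]
    [NormedAddCommGroup F] [NormedSpace ℝ F] [CompleteSpace F]
    (f : X × ℝ → F) (hf : ContDiff ℝ 1 f) (x : X) :
    HasFDerivAt (fun x => ∫ τ in (0:ℝ)..1, f (x, τ))
      (∫ τ in (0:ℝ)..1, (fderiv ℝ f (x, τ)).comp (ContinuousLinearMap.inl ℝ X ℝ)) x := by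
  have hcf : Continuous f := hf.continuous
  have hcd : Continuous (fun z : X × ℝ => (fderiv ℝ f z).comp (ContinuousLinearMap.inl ℝ X ℝ)) := by
    have := hf.continuous_fderiv one_ne_zero
    fun_prop
  obtain ⟨M, hM⟩ := ((isCompact_closedBall x 1).prod (isCompact_Icc (a := (0:ℝ)) (b := 1))
    ).exists_bound_of_continuousOn hcd.continuousOn
  refine intervalIntegral.hasFDerivAt_integral_of_dominated_of_fderiv_le
    (F' := fun x τ => (fderiv ℝ f (x, τ)).comp (ContinuousLinearMap.inl ℝ X ℝ))
    (s := Metric.closedBall x 1)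
    (bound := fun _ => M) (Metric.closedBall_mem_nhds x one_pos) ?_ ?_ ?_ ?_ ?_ ?_
  · filter_upwards with y
    exact (by fun_prop : Continuous fun τ => f (y, τ)).aestronglyMeasurable
  · exact (by fun_prop : Continuous fun τ => f (x, τ)).intervalIntegrable _ _
  · exact (hcd.comp (by fun_prop : Continuous fun τ : ℝ => (x, τ))).aestronglyMeasurable
  · filter_upwards with τ hτ y hy
    refine hM (y, τ) ⟨hy, ?_⟩
    rw [uIoc_of_le zero_le_one] at hτ
    exact ⟨hτ.1.le, hτ.2⟩
  · exact intervalIntegrable_const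
  · filter_upwards with τ hτ y hy
    have h1 : HasFDerivAt f (fderiv ℝ f (y, τ)) (y, τ) :=
      (hf.differentiable one_ne_zero _).hasFDerivAt
    exact h1.comp y (hasFDerivAt_prodMk_left y τ)

theorem sp_param {X : Type} [NormedAddCommGroup X] [NormedSpace ℝ X]
    [FiniteDimensional ℝ X] (m : ℕ) :
    ∀ {F : Type} [NormedAddCommGroup F] [NormedSpace ℝ F] [CompleteSpace F]
    (f : X × ℝ → F) (_ : ContDiff ℝ (⊤ : ℕ∞) f),
    ContDiff ℝ m (fun x => ∫ τ in (0:ℝ)..1, f (x, τ)) := by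
  induction m with
  | zero =>
    intro F _ _ _ f hf
    rw [Nat.cast_zero, contDiff_zero, continuous_iff_continuousAt]
    intro x
    exact (sp_param_aux f (hf.of_le (by exact_mod_cast le_top)) x).continuousAt
  | succ m ih =>
    intro F _ _ _ f hf
    have h1 : ContDiff ℝ 1 f := hf.of_le (by exact_mod_cast le_top)
    rw [show ((m + 1 : ℕ) : WithTop ℕ∞) = (m : WithTop ℕ∞) + 1 by push_cast; rfl,
      contDiff_succ_iff_hasFDerivAt]
    refine ⟨_, ih (fun z => (fderiv ℝ f z).comp (ContinuousLinearMap.inl ℝ X ℝ)) ?_,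
      fun x => sp_param_aux f h1 x⟩
    have : ContDiff ℝ (⊤ : ℕ∞) (fderiv ℝ f) := hf.fderiv_right (by simp)
    exact this.clm_comp contDiff_const

theorem sp_param' {X F : Type} [NormedAddCommGroup X] [NormedSpace ℝ X]
    [FiniteDimensional ℝ X] [NormedAddCommGroup F] [NormedSpace ℝ F] [CompleteSpace F]
    (f : X × ℝ → F) (hf : ContDiff ℝ (⊤ : ℕ∞) f) :
    ContDiff ℝ (⊤ : ℕ∞) (fun x => ∫ τ in (0:ℝ)..1, f (x, τ)) :=
  contDiff_infty.2 fun m => sp_param m f hf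

theorem sp_nonstat {P E : Type} [NormedAddCommGroup P] [NormedSpace ℝ P]
    [NormedAddCommGroup E] [NormedSpace ℝ E] [FiniteDimensional ℝ E]
    [MeasurableSpace E] [BorelSpace E] (μ : Measure E) [μ.IsAddHaarMeasure]
    (Q : Set P) (hQ : IsCompact Q) (K : Set E) (hK : IsCompact K)
    (s : P × E → ℝ) (hs : ContDiff ℝ (⊤ : ℕ∞) s) (w : P → E) (hw : ContDiff ℝ (⊤ : ℕ∞) w)
    (c : ℝ) (hc : 0 < c) (N : ℕ) : ∀ (a : P × E → ℂ), ContDiff ℝ (⊤ : ℕ∞) a →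
    (∀ p ∈ Q, ∀ ξ, a (p, ξ) ≠ 0 → ξ ∈ K ∧ c ≤ s (p, ξ)) →
    ∃ C, 0 ≤ C ∧ ∀ p ∈ Q, ∀ l : ℝ, (l ≠ 0 ∨ N = 0) → ∀ Φ : E → ℝ, ContDiff ℝ 1 Φ →
      (∀ ξ, fderiv ℝ Φ ξ (w p) = l * s (p, ξ)) →
      ‖∫ ξ, Complex.exp (Complex.I * (Φ ξ : ℂ)) * a (p, ξ) ∂μ‖ ≤ C * (|l|⁻¹) ^ N := by
  obtain ⟨θ, hθ, hθ1⟩ := sp_theta c hc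
  induction N with
  | zero =>
    intro a ha hsupp
    obtain ⟨M, hM⟩ := (hQ.prod hK).exists_bound_of_continuousOn ha.continuous.continuousOn
    refine ⟨|M| * μ.real K, by positivity, ?_⟩
    intro p hp l hl Φ hΦ hd
    have h0 : ∫ ξ, Complex.exp (Complex.I * (Φ ξ : ℂ)) * a (p, ξ) ∂μ =
        ∫ ξ in K, Complex.exp (Complex.I * (Φ ξ : ℂ)) * a (p, ξ) ∂μ := by
      rw [setIntegral_eq_integral_of_forall_compl_eq_zero]
      intro ξ hξ
      have : a (p, ξ) = 0 := by
        by_contra h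
        exact hξ (hsupp p hp ξ h).1
      rw [this, mul_zero]
    rw [h0, pow_zero, mul_one]
    refine norm_setIntegral_le_of_norm_le_const hK.measure_lt_top ?_
    intro ξ hξ
    rw [norm_mul, mul_comm Complex.I, Complex.norm_exp_ofReal_mul_I, one_mul]
    exact (hM (p, ξ) ⟨hp, hξ⟩).trans (le_abs_self M)
  | succ N ih =>
    intro a ha hsupp
    have hb : ContDiff ℝ (⊤ : ℕ∞) (fun z : P × E => a z * ((θ (s z) : ℝ) : ℂ)) :=
      ha.mul (Complex.ofRealCLM.contDiff.comp (hθ.comp hs))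
    set b : P × E → ℂ := fun z => a z * ((θ (s z) : ℝ) : ℂ) with hbdef
    set a' : P × E → ℂ := fun z => fderiv ℝ b z (0, w z.1) with ha'
    have ha's : ContDiff ℝ (⊤ : ℕ∞) a' := by
      have h1 : ContDiff ℝ (⊤ : ℕ∞) (fderiv ℝ b) := hb.fderiv_right (by simp)
      exact h1.clm_apply (contDiff_const.prodMk (hw.comp contDiff_fst))
    -- partial derivative
    have hpart : ∀ p ξ, HasFDerivAt (fun ξ => b (p, ξ))
        ((fderiv ℝ b (p, ξ)).comp (ContinuousLinearMap.inr ℝ P E)) ξ := by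
      intro p ξ
      have h1 : HasFDerivAt b (fderiv ℝ b (p, ξ)) (p, ξ) :=
        (hb.differentiable (by simp) _).hasFDerivAt
      exact h1.comp ξ (hasFDerivAt_prodMk_right p ξ)
    have hcl : ∀ p ∈ Q, ∀ ξ, ξ ∈ closure {ξ | a (p, ξ) ≠ 0} → ξ ∈ K ∧ c ≤ s (p, ξ) := by
      intro p hp ξ hξ
      have hclosed : IsClosed {ξ | ξ ∈ K ∧ c ≤ s (p, ξ)} := by
        have := hs.continuous
        exact hK.isClosed.and (isClosed_le continuous_const (by fun_prop))
      exact hclosed.closure_subset_iff.2 (fun ξ hξ => hsupp p hp ξ hξ) hξ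
    have hsupp' : ∀ p ∈ Q, ∀ ξ, a' (p, ξ) ≠ 0 → ξ ∈ K ∧ c ≤ s (p, ξ) := by
      intro p hp ξ hξ
      apply hcl p hp
      by_contra hn
      apply hξ
      have h2 : (fun ξ => b (p, ξ)) =ᶠ[nhds ξ] fun _ => 0 := by
        have : (closure {ξ | a (p, ξ) ≠ 0})ᶜ ∈ nhds ξ :=
          isClosed_closure.isOpen_compl.mem_nhds hn
        filter_upwards [this] with y hy
        have : a (p, y) = 0 := by
          by_contra h
          exact hy (subset_closure h)
        simp [hbdef, this]
      have h3 := (hpart p ξ).unique ((hasFDerivAt_const (0:ℂ) ξ).congr_of_eventuallyEq h2)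
      have h4 := DFunLike.congr_fun h3 (w p)
      simpa [ha'] using h4
    obtain ⟨C, hC, hCb⟩ := ih a' ha's hsupp'
    refine ⟨C, hC, ?_⟩
    intro p hp l hl Φ hΦ hd
    have key : ∫ ξ, Complex.exp (Complex.I * (Φ ξ : ℂ)) * a' (p, ξ) ∂μ =
        - ((Complex.I * l) * ∫ ξ, Complex.exp (Complex.I * (Φ ξ : ℂ)) * a (p, ξ) ∂μ) := by
      have hΦc := hΦ.continuous
      have hexp : ∀ ξ, HasFDerivAt (fun ξ => Complex.exp (Complex.I * (Φ ξ : ℂ)))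
          (Complex.exp (Complex.I * (Φ ξ : ℂ)) •
            (Complex.I • (Complex.ofRealCLM.comp (fderiv ℝ Φ ξ)))) ξ := by
        intro ξ
        have h1 : HasFDerivAt Φ (fderiv ℝ Φ ξ) ξ :=
          (hΦ.differentiable one_ne_zero _).hasFDerivAt
        exact ((Complex.ofRealCLM.hasFDerivAt.comp ξ h1).const_mul Complex.I).cexp
      have hcs : ∀ g : E → ℂ, Continuous g → (∀ ξ, ξ ∉ K → g ξ = 0) → Integrable g μ := by
        intro g hg h0
        refine hg.integrable_of_hasCompactSupport (HasCompactSupport.intro hK ?_)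
        exact h0
      have hb0 : ∀ ξ, ξ ∉ K → b (p, ξ) = 0 := by
        intro ξ hξ
        have : a (p, ξ) = 0 := by
          by_contra h
          exact hξ (hsupp p hp ξ h).1
        simp [hbdef, this]
      have ha'0 : ∀ ξ, ξ ∉ K → a' (p, ξ) = 0 := by
        intro ξ hξ
        by_contra h
        exact hξ (hsupp' p hp ξ h).1
      have hbc := hb.continuous
      have ha'c := ha's.continuous
      have hdc : Continuous (fun ξ => fderiv ℝ Φ ξ (w p)) := by
        have := hΦ.continuous_fderiv one_ne_zero
        fun_prop
      have hfd1 : ∀ ξ, fderiv ℝ (fun ξ => b (p, ξ)) ξ (w p) = a' (p, ξ) := by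
        intro ξ; rw [(hpart p ξ).fderiv]; simp [ha']
      have hfd2 : ∀ ξ, fderiv ℝ (fun ξ => Complex.exp (Complex.I * (Φ ξ : ℂ))) ξ (w p) =
          Complex.exp (Complex.I * (Φ ξ : ℂ)) * (Complex.I * (fderiv ℝ Φ ξ (w p) : ℝ)) := by
        intro ξ; rw [(hexp ξ).fderiv]; simp
      have := integral_mul_fderiv_eq_neg_fderiv_mul_of_integrable (μ := μ) (v := w p)
        (f := fun ξ => Complex.exp (Complex.I * (Φ ξ : ℂ))) (g := fun ξ => b (p, ξ))
        ?_ ?_ ?_ (fun ξ _ => (hexp ξ).differentiableAt) (fun ξ _ => (hpart p ξ).differentiableAt)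
      · simp only [hfd1, hfd2] at this
        rw [this, ← integral_const_mul]
        congr 1
        refine integral_congr_ae (Filter.Eventually.of_forall fun ξ => ?_)
        simp only [hd, hbdef]
        by_cases h : a (p, ξ) = 0
        · simp [h]
        · have h1 := hθ1 _ (hsupp p hp ξ h).2
          have h2 : ((θ (s (p, ξ)) : ℝ) : ℂ) * ((s (p, ξ) : ℝ) : ℂ) = 1 := by
            exact_mod_cast h1
          push_cast
          linear_combination (Complex.exp (Complex.I * (Φ ξ : ℂ)) * Complex.I * l * a (p, ξ)) * h2
      · simp only [hfd2]
        refine hcs _ (by fun_prop) ?_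
        intro ξ hξ; simp [hb0 ξ hξ]
      · simp only [hfd1]
        refine hcs _ (by fun_prop) ?_
        intro ξ hξ; simp [ha'0 ξ hξ]
      · refine hcs _ (by fun_prop) ?_
        intro ξ hξ; simp [hb0 ξ hξ]
    replace hl : l ≠ 0 := hl.resolve_right (by simp)
    have h5 := hCb p hp l (Or.inl hl) Φ hΦ hd
    rw [key, norm_neg, norm_mul, norm_mul, Complex.norm_I, one_mul, Complex.norm_real,
      Real.norm_eq_abs] at h5
    have hl' : 0 < |l| := abs_pos.2 hl
    rw [pow_succ, ← mul_assoc, ← div_eq_mul_inv, le_div_iff₀ hl', mul_comm]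
    exact h5

theorem sp_nonstat' {P E : Type} [NormedAddCommGroup P] [NormedSpace ℝ P]
    [NormedAddCommGroup E] [NormedSpace ℝ E] [FiniteDimensional ℝ E]
    [MeasurableSpace E] [BorelSpace E] (μ : Measure E) [μ.IsAddHaarMeasure]
    (Q : Set P) (hQ : IsCompact Q) (K : Set E) (hK : IsCompact K)
    (s : P × E → ℝ) (hs : ContDiff ℝ (⊤ : ℕ∞) s) (w : P → E) (hw : ContDiff ℝ (⊤ : ℕ∞) w)
    (c : ℝ) (hc : 0 < c) (N : ℕ) (a : P × E → ℂ) (ha : ContDiff ℝ (⊤ : ℕ∞) a)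
    (hsupp : ∀ p ∈ Q, ∀ ξ, a (p, ξ) ≠ 0 → ξ ∈ K ∧ c ≤ s (p, ξ)) :
    ∃ C, 0 ≤ C ∧ ∀ p ∈ Q, ∀ l : ℝ, ∀ Φ : E → ℝ, ContDiff ℝ 1 Φ →
      (∀ ξ, fderiv ℝ Φ ξ (w p) = l * s (p, ξ)) →
      ‖∫ ξ, Complex.exp (Complex.I * (Φ ξ : ℂ)) * a (p, ξ) ∂μ‖ ≤ C * ((1 + |l|) ^ N)⁻¹ := by
  obtain ⟨C0, h0, H0⟩ := sp_nonstat μ Q hQ K hK s hs w hw c hc 0 a ha hsupp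
  obtain ⟨C1, h1, H1⟩ := sp_nonstat μ Q hQ K hK s hs w hw c hc N a ha hsupp
  refine ⟨2 ^ N * (C0 + C1), by positivity, ?_⟩
  intro p hp l Φ hΦ hd
  rw [← div_eq_mul_inv, le_div_iff₀ (by positivity)]
  rcases le_or_gt |l| 1 with hl | hl
  · have := H0 p hp l (Or.inr rfl) Φ hΦ hd
    rw [pow_zero, mul_one] at this
    calc _ ≤ C0 * 2 ^ N := by gcongr; linarith
      _ ≤ _ := by nlinarith [pow_pos (two_pos : (0:ℝ) < 2) N]
  · have hl0 : 0 < |l| := by linarith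
    have := H1 p hp l (Or.inl (abs_pos.1 hl0)) Φ hΦ hd
    calc _ ≤ C1 * (|l|⁻¹) ^ N * (2 * |l|) ^ N := by gcongr; linarith
      _ = C1 * 2 ^ N * (|l|⁻¹ * |l|) ^ N := by rw [mul_pow, mul_pow]; ring
      _ = C1 * 2 ^ N := by rw [inv_mul_cancel₀ hl0.ne']; simp
      _ ≤ _ := by nlinarith [pow_pos (two_pos : (0:ℝ) < 2) N]

theorem sp_cs {E : Type} [NormedAddCommGroup E] [MeasurableSpace E] [BorelSpace E]
    (μ : Measure E) [IsFiniteMeasureOnCompacts μ] (K : Set E) (hK : IsCompact K) (m : E → ℂ)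
    (hm : Continuous m) (h0 : ∀ ξ, ξ ∉ K → m ξ = 0) :
    ‖∫ ξ, m ξ ∂μ‖ ^ 2 ≤ μ.real K * ∫ ξ, ‖m ξ‖ ^ 2 ∂μ := by
  have e1 : ∫ ξ, ‖m ξ‖ ∂μ = ∫ ξ in K, ‖m ξ‖ ∂μ := by
    rw [setIntegral_eq_integral_of_forall_compl_eq_zero]
    intro ξ hξ; simp [h0 ξ hξ]
  have e2 : ∫ ξ, ‖m ξ‖ ^ 2 ∂μ = ∫ ξ in K, ‖m ξ‖ ^ 2 ∂μ := by
    rw [setIntegral_eq_integral_of_forall_compl_eq_zero]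
    intro ξ hξ; simp [h0 ξ hξ]
  have h1 : ‖∫ ξ, m ξ ∂μ‖ ≤ ∫ ξ in K, ‖m ξ‖ ∂μ := e1 ▸ norm_integral_le_integral_norm _
  have i1 : IntegrableOn (fun ξ => ‖m ξ‖) K μ := (hm.norm.continuousOn).integrableOn_compact hK
  have i2 : IntegrableOn (fun ξ => ‖m ξ‖ ^ 2) K μ :=
    ((hm.norm.pow 2).continuousOn).integrableOn_compact hK
  have i0 : ∀ c : ℝ, IntegrableOn (fun _ => c) K μ := fun c =>
    (continuous_const.continuousOn).integrableOn_compact hK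
  have key : ∀ c : ℝ, 0 ≤ (∫ ξ in K, ‖m ξ‖ ^ 2 ∂μ) - 2 * c * (∫ ξ in K, ‖m ξ‖ ∂μ)
      + c ^ 2 * μ.real K := by
    intro c
    have : 0 ≤ ∫ ξ in K, (‖m ξ‖ ^ 2 - 2 * c * ‖m ξ‖ + c ^ 2) ∂μ := by
      apply integral_nonneg
      intro ξ
      simp only [Pi.zero_apply]
      nlinarith [sq_nonneg (‖m ξ‖ - c)]
    have i3 : IntegrableOn (fun ξ => 2 * c * ‖m ξ‖) K μ := i1.const_mul _
    have i4 : IntegrableOn (fun ξ => ‖m ξ‖ ^ 2 - 2 * c * ‖m ξ‖) K μ := i2.sub i3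
    rw [integral_add i4 (i0 _), integral_sub i2 i3,
      integral_const_mul, setIntegral_const, smul_eq_mul] at this
    linarith
  rw [e2]
  set J := ∫ ξ in K, ‖m ξ‖ ∂μ
  have hJ : ‖∫ ξ, m ξ ∂μ‖ ^ 2 ≤ J ^ 2 := by gcongr
  refine hJ.trans ?_
  rcases eq_or_lt_of_le (measureReal_nonneg (μ := μ) (s := K)) with hV | hV
  · have hJ0 : J = 0 := by
      have : μ K = 0 := by
        rw [measureReal_def, eq_comm, ENNReal.toReal_eq_zero_iff] at hV
        exact hV.resolve_right hK.measure_lt_top.ne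
      simp [J, Measure.restrict_eq_zero.2 this]
    simp [hJ0, ← hV]
  · have := key (J / μ.real K)
    have h2 : 0 ≤ μ.real K * ((∫ ξ in K, ‖m ξ‖ ^ 2 ∂μ) - 2 * (J / μ.real K) * J
      + (J / μ.real K) ^ 2 * μ.real K) := by positivity
    have h3 : μ.real K * ((∫ ξ in K, ‖m ξ‖ ^ 2 ∂μ) - 2 * (J / μ.real K) * J
      + (J / μ.real K) ^ 2 * μ.real K) = μ.real K * (∫ ξ in K, ‖m ξ‖ ^ 2 ∂μ) - J ^ 2 := by
      field_simp; ring
    linarith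

theorem sp_tt {V E : Type} [NormedAddCommGroup V] [NormedSpace ℝ V] [FiniteDimensional ℝ V]
    [MeasurableSpace V] [BorelSpace V] [HasContDiffBump V] (ν : Measure V) [ν.IsAddHaarMeasure]
    [NormedAddCommGroup E] [NormedSpace ℝ E] [FiniteDimensional ℝ E]
    [MeasurableSpace E] [BorelSpace E] (μ : Measure E) [μ.IsAddHaarMeasure]
    (A : V →L[ℝ] E) (K : Set E) (hK : IsCompact K) :
    ∃ C, 0 ≤ C ∧ ∀ F : E → ℂ, Continuous F → (∀ ξ, ξ ∉ K → F ξ = 0) →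
      ∀ G : V → ℝ, Continuous G → (∀ v, 0 ≤ G v) → Integrable G ν →
      (∀ v, ‖v‖ ≤ 2 → ‖∫ ξ, F (ξ + A v) * (starRingEnd ℂ) (F ξ) ∂μ‖ ≤ G v) →
      ‖∫ ξ, F ξ ∂μ‖ ^ 2 ≤ C * ∫ v, G v ∂ν := by
  let β : ContDiffBump (0 : V) := ⟨1 / 2, 1, by norm_num, by norm_num⟩
  have hβc : Continuous β := β.continuous
  have hβ0 : ∀ u, u ∉ Metric.closedBall (0 : V) 1 → β u = 0 := by
    intro u hu
    apply β.zero_of_le_dist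
    simp only [Metric.mem_closedBall, not_le] at hu
    exact hu.le
  have hβI : 0 < ∫ u, β u ∂ν := β.integral_pos
  set b := ∫ u, β u ∂ν with hb
  set K' : Set E := (fun z : E × V => z.1 - A z.2) '' (K ×ˢ Metric.closedBall (0 : V) 1) with hK'
  have hK'c : IsCompact K' :=
    (hK.prod (isCompact_closedBall _ _)).image (by fun_prop)
  refine ⟨μ.real K' / b, by positivity, ?_⟩
  intro F hF hF0 G hG hG0 hGi hbound
  have hFK' : ∀ ξ u, ξ ∉ K' → u ∈ Metric.closedBall (0 : V) 1 → F (ξ + A u) = 0 := by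
    intro ξ u hξ hu
    apply hF0
    intro h
    exact hξ ⟨(ξ + A u, u), ⟨h, hu⟩, by simp⟩
  have hFz : ∀ ξ u, ξ ∉ K' → (β u : ℂ) * F (ξ + A u) = 0 := by
    intro ξ u hξ
    by_cases hu : u ∈ Metric.closedBall (0 : V) 1
    · rw [hFK' ξ u hξ hu, mul_zero]
    · rw [hβ0 u hu]; simp
  set m : E → ℂ := fun ξ => ∫ u, (β u : ℂ) * F (ξ + A u) ∂ν with hm
  have hm0 : ∀ ξ, ξ ∉ K' → m ξ = 0 := by
    intro ξ hξ
    simp [hm, hFz ξ _ hξ]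
  have hmc : Continuous m := by
    have : m = fun ξ => ∫ u in Metric.closedBall (0 : V) 1, (β u : ℂ) * F (ξ + A u) ∂ν := by
      ext ξ
      rw [setIntegral_eq_integral_of_forall_compl_eq_zero]
      intro u hu
      rw [hβ0 u hu]; simp
    rw [this]
    refine continuous_parametric_integral_of_continuous ?_ (isCompact_closedBall _ _)
    simp only [Function.uncurry_def]
    fun_prop
  have h1 : (b : ℂ) * ∫ ξ, F ξ ∂μ = ∫ ξ, m ξ ∂μ := by
    rw [hm, integral_integral_swap_of_hasCompactSupport]
    · have : ∀ u, ∫ ξ, (β u : ℂ) * F (ξ + A u) ∂μ = (β u : ℂ) * ∫ ξ, F ξ ∂μ := by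
        intro u
        rw [integral_const_mul, integral_add_right_eq_self (μ := μ) F]
      simp only [this]
      rw [integral_mul_const, integral_complex_ofReal]
    · simp only [Function.uncurry_def]
      fun_prop
    · refine HasCompactSupport.intro (hK'c.prod (isCompact_closedBall (0 : V) 1)) ?_
      rintro ⟨ξ, u⟩ hz
      simp only [Function.uncurry_apply_pair]
      by_cases hu : u ∈ Metric.closedBall (0 : V) 1
      · exact hFz ξ u (fun h => hz ⟨h, hu⟩)
      · rw [hβ0 u hu]; simp
  have h2 := sp_cs μ K' hK'c m hmc hm0
  set g : V → ℂ := fun v => ∫ ξ, F (ξ + A v) * (starRingEnd ℂ) (F ξ) ∂μ with hg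
  have h3 : ((∫ ξ, ‖m ξ‖ ^ 2 ∂μ : ℝ) : ℂ) =
      ∫ z : V × V, ((β z.1 : ℂ) * (β z.2 : ℂ)) * g (z.1 - z.2) ∂(ν.prod ν) := by
    rw [← integral_complex_ofReal]
    have e1 : ∀ ξ, ((‖m ξ‖ ^ 2 : ℝ) : ℂ) = ∫ z : V × V, ((β z.1 : ℂ) * F (ξ + A z.1)) *
        ((β z.2 : ℂ) * (starRingEnd ℂ) (F (ξ + A z.2))) ∂(ν.prod ν) := by
      intro ξ
      rw [integral_prod_mul (fun u => (β u : ℂ) * F (ξ + A u))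
        (fun u => (β u : ℂ) * (starRingEnd ℂ) (F (ξ + A u)))]
      have : ∫ u, (β u : ℂ) * (starRingEnd ℂ) (F (ξ + A u)) ∂ν = (starRingEnd ℂ) (m ξ) := by
        rw [hm, ← integral_conj]
        simp
      rw [this, Complex.mul_conj, Complex.normSq_eq_norm_sq]
    simp only [e1]
    rw [integral_integral_swap_of_hasCompactSupport]
    · congr 1
      ext z
      have : ∀ ξ, ((β z.1 : ℂ) * F (ξ + A z.1)) *
          ((β z.2 : ℂ) * (starRingEnd ℂ) (F (ξ + A z.2))) =
          ((β z.1 : ℂ) * (β z.2 : ℂ)) *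
          (fun y => F (y + A (z.1 - z.2)) * (starRingEnd ℂ) (F y)) (ξ + A z.2) := by
        intro ξ
        have : ξ + A z.2 + A (z.1 - z.2) = ξ + A z.1 := by
          rw [map_sub]; abel
        simp only [this]
        ring
      simp only [this]
      rw [integral_const_mul, integral_add_right_eq_self (μ := μ)
        (fun y => F (y + A (z.1 - z.2)) * (starRingEnd ℂ) (F y))]
    · simp only [Function.uncurry_def]
      have := Complex.continuous_conj
      fun_prop
    · refine HasCompactSupport.intro (hK'c.prod ((isCompact_closedBall (0 : V) 1).prod
        (isCompact_closedBall (0 : V) 1))) ?_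
      rintro ⟨ξ, u, v⟩ hz
      simp only [Function.uncurry_apply_pair]
      by_cases hξ : ξ ∈ K'
      · by_cases hu : u ∈ Metric.closedBall (0 : V) 1
        · by_cases hv : v ∈ Metric.closedBall (0 : V) 1
          · exact absurd ⟨hξ, hu, hv⟩ hz
          · rw [hβ0 v hv]; simp
        · rw [hβ0 u hu]; simp
      · rw [hFz ξ u hξ, zero_mul]
  have hint : Integrable (fun z : V × V => (β z.1 * β z.2) * G (z.1 - z.2)) (ν.prod ν) := by
    refine Continuous.integrable_of_hasCompactSupport (by fun_prop)
      (HasCompactSupport.intro ((isCompact_closedBall (0 : V) 1).prod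
        (isCompact_closedBall (0 : V) 1)) ?_)
    rintro ⟨u, v⟩ hz
    by_cases hu : u ∈ Metric.closedBall (0 : V) 1
    · by_cases hv : v ∈ Metric.closedBall (0 : V) 1
      · exact absurd ⟨hu, hv⟩ hz
      · simp [hβ0 v hv]
    · simp [hβ0 u hu]
  have h4 : ∫ ξ, ‖m ξ‖ ^ 2 ∂μ ≤
      ∫ z : V × V, (β z.1 * β z.2) * G (z.1 - z.2) ∂(ν.prod ν) := by
    have : ∫ ξ, ‖m ξ‖ ^ 2 ∂μ = ‖((∫ ξ, ‖m ξ‖ ^ 2 ∂μ : ℝ) : ℂ)‖ := by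
      rw [Complex.norm_real, Real.norm_of_nonneg]
      exact integral_nonneg fun ξ => by positivity
    rw [this, h3]
    refine norm_integral_le_of_norm_le hint (Filter.Eventually.of_forall ?_)
    rintro ⟨u, v⟩
    simp only [norm_mul, Complex.norm_real, Real.norm_of_nonneg β.nonneg]
    by_cases hu : u ∈ Metric.closedBall (0 : V) 1
    · by_cases hv : v ∈ Metric.closedBall (0 : V) 1
      · refine mul_le_mul_of_nonneg_left ?_ (mul_nonneg β.nonneg β.nonneg)
        apply hbound
        rw [mem_closedBall_zero_iff] at hu hv
        linarith [norm_sub_le u v]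
      · simp [hβ0 v hv]
    · simp [hβ0 u hu]
  have h5 : ∫ z : V × V, (β z.1 * β z.2) * G (z.1 - z.2) ∂(ν.prod ν) ≤ b * ∫ v, G v ∂ν := by
    rw [integral_prod_symm _ hint, hb, ← integral_mul_const]
    refine integral_mono hint.integral_prod_right ?_ ?_
    · exact (hβc.integrable_of_hasCompactSupport β.hasCompactSupport).mul_const _
    · intro v
      simp only
      rw [← integral_sub_right_eq_self (μ := ν) G v, ← integral_const_mul]
      refine integral_mono_of_nonneg ?_ ((hGi.comp_sub_right v).const_mul _) ?_
      · exact Filter.Eventually.of_forall fun u =>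
          mul_nonneg (mul_nonneg β.nonneg β.nonneg) (hG0 _)
      · refine Filter.Eventually.of_forall fun u => ?_
        simp only
        refine mul_le_mul_of_nonneg_right ?_ (hG0 _)
        exact mul_le_of_le_one_left β.nonneg β.le_one
  have h6 : b ^ 2 * ‖∫ ξ, F ξ ∂μ‖ ^ 2 ≤ μ.real K' * (b * ∫ v, G v ∂ν) := by
    have : b ^ 2 * ‖∫ ξ, F ξ ∂μ‖ ^ 2 = ‖∫ ξ, m ξ ∂μ‖ ^ 2 := by
      rw [← h1, norm_mul, Complex.norm_real, Real.norm_of_nonneg hβI.le, mul_pow]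
    rw [this]
    refine h2.trans ?_
    gcongr
    exact h4.trans h5
  have h7 : b * (b * ‖∫ ξ, F ξ ∂μ‖ ^ 2) ≤ b * (μ.real K' * ∫ v, G v ∂ν) := by linarith
  have h8 := le_of_mul_le_mul_left h7 hβI
  rw [div_mul_eq_mul_div, le_div_iff₀ hβI]
  linarith

theorem sp_hadamard {E : Type} [NormedAddCommGroup E] [NormedSpace ℝ E]
    (φ : E → ℝ) (hφ : ContDiff ℝ (⊤ : ℕ∞) φ) (ξ a w : E) (r : ℝ) :
    r * ∫ τ in (0:ℝ)..1, fderiv ℝ (fderiv ℝ φ) (ξ + τ • r • a) a w =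
      fderiv ℝ φ (ξ + r • a) w - fderiv ℝ φ ξ w := by
  have h1 : ContDiff ℝ (⊤ : ℕ∞) (fderiv ℝ φ) := hφ.fderiv_right (by simp)
  have h2 : Continuous (fderiv ℝ (fderiv ℝ φ)) := h1.continuous_fderiv (by simp)
  have hd : ∀ τ : ℝ, HasDerivAt (fun τ : ℝ => fderiv ℝ φ (ξ + τ • r • a) w)
      (r * fderiv ℝ (fderiv ℝ φ) (ξ + τ • r • a) a w) τ := by
    intro τ
    have e1 : HasDerivAt (fun τ : ℝ => ξ + τ • r • a) (r • a) τ := by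
      simpa using ((hasDerivAt_id τ).smul_const (r • a)).const_add ξ
    have e2 : HasFDerivAt (fderiv ℝ φ) (fderiv ℝ (fderiv ℝ φ) (ξ + τ • r • a)) (ξ + τ • r • a) :=
      (h1.differentiable (by simp) _).hasFDerivAt
    have e3 : HasDerivAt (fun τ : ℝ => fderiv ℝ φ (ξ + τ • r • a))
      (fderiv ℝ (fderiv ℝ φ) (ξ + τ • r • a) (r • a)) τ := e2.comp_hasDerivAt τ e1
    have e4 := (ContinuousLinearMap.apply ℝ ℝ w).hasFDerivAt.comp_hasDerivAt τ e3
    have e5 : r * fderiv ℝ (fderiv ℝ φ) (ξ + τ • r • a) a w =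
        fderiv ℝ (fderiv ℝ φ) (ξ + τ • r • a) (r • a) w := by
      rw [map_smul]; rfl
    rw [e5]
    exact e4
  rw [← intervalIntegral.integral_const_mul,
    intervalIntegral.integral_eq_sub_of_hasDerivAt (fun τ _ => hd τ)]
  · simp
  · exact (by fun_prop : Continuous fun τ : ℝ =>
      r * fderiv ℝ (fderiv ℝ φ) (ξ + τ • r • a) a w).intervalIntegrable _ _

theorem sp_local {V E : Type} [NormedAddCommGroup V] [NormedSpace ℝ V] [FiniteDimensional ℝ V]
    [MeasurableSpace V] [BorelSpace V] [HasContDiffBump V] [Nontrivial V]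
    (ν : Measure V) [ν.IsAddHaarMeasure]
    [NormedAddCommGroup E] [NormedSpace ℝ E] [FiniteDimensional ℝ E]
    [MeasurableSpace E] [BorelSpace E] (μ : Measure E) [μ.IsAddHaarMeasure]
    (φ : E → ℝ) (hφ : ContDiff ℝ (⊤ : ℕ∞) φ) (A W : V →L[ℝ] E) (c : ℝ) (hc : 0 < c)
    (K : Set E) (hK : IsCompact K) (hKc : Convex ℝ K)
    (hpos : ∀ ξ ∈ K, ∀ ω : V, ‖ω‖ = 1 → c ≤ fderiv ℝ (fderiv ℝ φ) ξ (A ω) (W ω))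
    (η : E → ℂ) (hη : ContDiff ℝ (⊤ : ℕ∞) η) (hη0 : ∀ ξ, ξ ∉ K → η ξ = 0) :
    ∃ C, 0 ≤ C ∧ ∀ (L : E →L[ℝ] ℝ) (t : ℝ), t ≠ 0 →
      ‖∫ ξ, Complex.exp (Complex.I * ((L ξ + t * φ ξ : ℝ) : ℂ)) * η ξ ∂μ‖ ^ 2 ≤
        C * (|t| ^ Module.finrank ℝ V)⁻¹ := by
  have h1 : ContDiff ℝ (⊤ : ℕ∞) (fderiv ℝ φ) := hφ.fderiv_right (by simp)
  have h2 : ContDiff ℝ (⊤ : ℕ∞) (fderiv ℝ (fderiv ℝ φ)) := h1.fderiv_right (by simp)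
  set s : (ℝ × V) × E → ℝ := fun z => ∫ τ in (0:ℝ)..1,
    fderiv ℝ (fderiv ℝ φ) (z.2 + τ • z.1.1 • A z.1.2) (A z.1.2) (W z.1.2) with hsdef
  have hs : ContDiff ℝ (⊤ : ℕ∞) s := by
    refine sp_param' (fun y : ((ℝ × V) × E) × ℝ =>
      fderiv ℝ (fderiv ℝ φ) (y.1.2 + y.2 • y.1.1.1 • A y.1.1.2) (A y.1.1.2) (W y.1.1.2)) ?_
    fun_prop
  set N := Module.finrank ℝ V + 1 with hN
  set a : (ℝ × V) × E → ℂ := fun z => η (z.2 + z.1.1 • A z.1.2) * (starRingEnd ℂ) (η z.2)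
    with hadef
  have ha : ContDiff ℝ (⊤ : ℕ∞) a := by
    have hcj : ContDiff ℝ (⊤ : ℕ∞) (fun z : ℂ => (starRingEnd ℂ) z) :=
      Complex.conjCLE.contDiff
    exact (hη.comp (by fun_prop)).mul (hcj.comp (hη.comp contDiff_snd))
  have hsupp : ∀ p ∈ Icc (0:ℝ) 2 ×ˢ Metric.sphere (0 : V) 1, ∀ ξ, a (p, ξ) ≠ 0 →
      ξ ∈ K ∧ c ≤ s (p, ξ) := by
    rintro ⟨r, ω⟩ ⟨hr, hω⟩ ξ hne
    have k1 : ξ ∈ K := by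
      by_contra h
      exact hne (by simp [hadef, hη0 ξ h])
    have k2 : ξ + r • A ω ∈ K := by
      by_contra h
      exact hne (by simp [hadef, hη0 _ h])
    refine ⟨k1, ?_⟩
    have hω' : ‖ω‖ = 1 := by simpa using hω
    have hcont : Continuous fun τ : ℝ =>
        fderiv ℝ (fderiv ℝ φ) (ξ + τ • r • A ω) (A ω) (W ω) := by
      have := h2.continuous
      fun_prop
    have : ∫ τ in (0:ℝ)..1, c ≤ s ((r, ω), ξ) := by
      refine intervalIntegral.integral_mono_on zero_le_one intervalIntegrable_const
        (hcont.intervalIntegrable _ _) ?_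
      intro τ hτ
      refine hpos _ ?_ ω hω'
      have := hKc.add_smul_sub_mem k1 k2 hτ
      simpa using this
    simpa using this
  obtain ⟨C1, hC1, H1⟩ := sp_nonstat' μ (Icc (0:ℝ) 2 ×ˢ Metric.sphere (0 : V) 1)
    (isCompact_Icc.prod (isCompact_sphere _ _)) K hK s hs (fun p => W p.2) (by fun_prop) c hc N a ha
    hsupp
  obtain ⟨C2, hC2, H2⟩ := sp_tt ν μ A K hK
  set J := ∫ v : V, ((1 + ‖v‖) ^ N)⁻¹ ∂ν with hJ
  have hJ0 : 0 ≤ J := integral_nonneg fun v => by positivity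
  have hJi : Integrable (fun v : V => ((1 + ‖v‖) ^ N)⁻¹) ν := by
    have := integrable_one_add_norm (E := V) (μ := ν) (r := (N : ℝ)) (by rw [hN]; push_cast; linarith)
    refine this.congr (Filter.Eventually.of_forall fun v => ?_)
    simp only
    rw [Real.rpow_neg (by positivity), Real.rpow_natCast]
  refine ⟨C2 * (C1 * J), by positivity, ?_⟩
  intro L t ht
  have hφc := hφ.continuous
  have hηc := hη.continuous
  have hsc : ∀ v : V, (1 + |t| * ‖v‖) = 1 + ‖t • v‖ := fun v => by rw [norm_smul, Real.norm_eq_abs]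
  have hGi : Integrable (fun v : V => C1 * ((1 + |t| * ‖v‖) ^ N)⁻¹) ν := by
    simp only [hsc]
    exact (hJi.comp_smul ht).const_mul C1
  have := H2 (fun ξ => Complex.exp (Complex.I * ((L ξ + t * φ ξ : ℝ) : ℂ)) * η ξ) (by fun_prop)
    (fun ξ hξ => by simp [hη0 ξ hξ]) (fun v => C1 * ((1 + |t| * ‖v‖) ^ N)⁻¹) ?_ ?_ hGi ?_
  · refine this.trans_eq ?_
    rw [integral_const_mul]
    simp only [hsc]
    rw [Measure.integral_comp_smul ν (fun v : V => ((1 + ‖v‖) ^ N)⁻¹), smul_eq_mul, ← hJ,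
      abs_inv, abs_pow]
    ring
  · refine continuous_const.mul (Continuous.inv₀ (by fun_prop) fun v => ?_)
    positivity
  · intro v; positivity
  · intro v hv
    obtain ⟨ω, hω, hvω⟩ : ∃ ω : V, ‖ω‖ = 1 ∧ v = ‖v‖ • ω := by
      by_cases h0 : v = 0
      · obtain ⟨ω, hω⟩ := exists_norm_eq V zero_le_one
        exact ⟨ω, hω, by simp [h0]⟩
      · refine ⟨‖v‖⁻¹ • v, ?_, ?_⟩
        · rw [norm_smul, norm_inv, norm_norm, inv_mul_cancel₀ (norm_ne_zero_iff.2 h0)]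
        · rw [smul_smul, mul_inv_cancel₀ (norm_ne_zero_iff.2 h0), one_smul]
    have hAv : A v = ‖v‖ • A ω := by
      conv_lhs => rw [hvω]
      rw [map_smul]
    have := H1 (‖v‖, ω) ⟨⟨norm_nonneg v, hv⟩, by simpa using hω⟩ (t * ‖v‖)
      (fun ξ => L (A v) + t * (φ (ξ + A v) - φ ξ)) ?_ ?_
    · rw [abs_mul, abs_norm] at this
      convert this using 4 with ξ
      rw [hadef]
      simp only
      rw [← hAv, map_mul, ← Complex.exp_conj, map_mul, Complex.conj_I, Complex.conj_ofReal,
        mul_mul_mul_comm, ← Complex.exp_add]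
      congr 2
      rw [map_add]
      push_cast
      ring
    · have : ContDiff ℝ 1 φ := hφ.of_le (by exact_mod_cast le_top)
      fun_prop
    · intro ξ
      have d1 : ∀ y, HasFDerivAt φ (fderiv ℝ φ y) y := fun y =>
        (hφ.differentiable (by simp) y).hasFDerivAt
      have d2 : HasFDerivAt (fun ξ => φ (ξ + A v)) (fderiv ℝ φ (ξ + A v)) ξ :=
        (hasFDerivAt_comp_add_right (A v)).2 (d1 _)
      have d3 := (((d2.sub (d1 ξ)).const_mul t).const_add (L (A v))).fderiv
      have d4 := sp_hadamard φ hφ ξ (A ω) (W ω) ‖v‖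
      simp only [Pi.sub_apply] at d3
      rw [d3]
      simp only [hsdef]
      rw [mul_assoc, d4, hAv]
      simp

theorem sp_large {E : Type} [NormedAddCommGroup E] [InnerProductSpace ℝ E] [FiniteDimensional ℝ E]
    [MeasurableSpace E] [BorelSpace E] (μ : Measure E) [μ.IsAddHaarMeasure]
    (φ : E → ℝ) (hφ : ContDiff ℝ (⊤ : ℕ∞) φ) (N : ℕ)
    (K : Set E) (hK : IsCompact K)
    (η : E → ℂ) (hη : ContDiff ℝ (⊤ : ℕ∞) η) (hη0 : ∀ ξ, ξ ∉ K → η ξ = 0) :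
    ∃ B C : ℝ, 0 < B ∧ 0 ≤ C ∧ ∀ (x : E) (t : ℝ), x ≠ 0 → B * |t| ≤ ‖x‖ →
      ‖∫ ξ, Complex.exp (Complex.I * ((inner ℝ x ξ + t * φ ξ : ℝ) : ℂ)) * η ξ ∂μ‖ ≤
        C * ((1 + ‖x‖) ^ N)⁻¹ := by
  have h1 : ContDiff ℝ (⊤ : ℕ∞) (fderiv ℝ φ) := hφ.fderiv_right (by simp)
  obtain ⟨M, hM⟩ := hK.exists_bound_of_continuousOn h1.continuous.continuousOn
  set B := 2 * (|M| + 1) with hB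
  have hB0 : 0 < B := by positivity
  set s : (ℝ × E) × E → ℝ := fun z => 1 + z.1.1 * fderiv ℝ φ z.2 z.1.2 with hsdef
  obtain ⟨C, hC, H⟩ := sp_nonstat' μ (Icc (-B⁻¹) (B⁻¹) ×ˢ Metric.sphere (0 : E) 1)
    (isCompact_Icc.prod (isCompact_sphere _ _)) K hK s (by fun_prop) (fun p => p.2) (by fun_prop)
    (1/2) (by norm_num) N (fun z => η z.2) (by fun_prop) (by
      rintro ⟨σ, ω⟩ ⟨hσ, hω⟩ ξ hne
      have k1 : ξ ∈ K := by
        by_contra h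
        exact hne (hη0 ξ h)
      refine ⟨k1, ?_⟩
      have hω' : ‖ω‖ = 1 := by simpa using hω
      have k2 : |fderiv ℝ φ ξ ω| ≤ |M| := by
        have := (fderiv ℝ φ ξ).le_opNorm ω
        rw [hω', mul_one, Real.norm_eq_abs] at this
        exact this.trans ((hM ξ k1).trans (le_abs_self M))
      have k3 : |σ| ≤ B⁻¹ := abs_le.2 hσ
      have k4 : |σ * fderiv ℝ φ ξ ω| ≤ 1 / 2 := by
        rw [abs_mul]
        calc _ ≤ B⁻¹ * |M| := by gcongr
          _ ≤ 1 / 2 := by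
            rw [inv_mul_le_iff₀ hB0, hB]; linarith [abs_nonneg M]
      have := (abs_le.1 k4).1
      simp only [hsdef]
      linarith)
  refine ⟨B, C, hB0, hC, ?_⟩
  intro x t hx hxt
  have hx0 : 0 < ‖x‖ := norm_pos_iff.2 hx
  have := H (t / ‖x‖, ‖x‖⁻¹ • x) ⟨?_, ?_⟩ ‖x‖ (fun ξ => inner ℝ x ξ + t * φ ξ) ?_ ?_
  · rw [abs_norm] at this
    exact this
  · refine abs_le.1 ?_
    rw [abs_div, abs_norm, div_le_iff₀ hx0, inv_mul_eq_div, le_div_iff₀ hB0]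
    linarith
  · simp [norm_smul, hx0.ne']
  · have : ContDiff ℝ 1 φ := hφ.of_le (by exact_mod_cast le_top)
    exact (contDiff_const.inner ℝ contDiff_id).add (contDiff_const.mul this)
  · intro ξ
    have d1 : HasFDerivAt φ (fderiv ℝ φ ξ) ξ := (hφ.differentiable (by simp) ξ).hasFDerivAt
    have d2 : HasFDerivAt (fun ξ => inner ℝ x ξ) (innerSL ℝ x) ξ := (innerSL ℝ x).hasFDerivAt
    have d3 : HasFDerivAt (fun ξ => inner ℝ x ξ + t * φ ξ) (innerSL ℝ x + t • fderiv ℝ φ ξ) ξ :=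
      d2.add (d1.const_mul t)
    rw [d3.fderiv]
    simp only [hsdef, add_apply, smul_apply,
      innerSL_apply_apply, real_inner_self_eq_norm_sq, map_smul, smul_eq_mul]
    field_simp

theorem sp_fin (k : ℕ) (I Y D : ℝ) (hY : 0 < Y) (hD : 0 ≤ D)
    (h : I ^ 2 * Y ^ k ≤ D ^ 2) : I ≤ D * Y ^ (-(k : ℝ) / 2) := by
  have e : Y ^ (-(k : ℝ) / 2) = (Y ^ ((k : ℝ) / 2))⁻¹ := by
    rw [neg_div, Real.rpow_neg hY.le]
  have hp : 0 < Y ^ ((k : ℝ) / 2) := Real.rpow_pos_of_pos hY _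
  rw [e, ← div_eq_mul_inv, le_div_iff₀ hp]
  refine le_of_sq_le_sq ?_ hD
  rw [mul_pow, ← Real.rpow_natCast (Y ^ ((k : ℝ) / 2)), ← Real.rpow_mul hY.le]
  push_cast
  rw [div_mul_cancel₀ _ two_ne_zero, Real.rpow_natCast]
  exact h

theorem sp_piece {V E : Type} [NormedAddCommGroup V] [NormedSpace ℝ V] [FiniteDimensional ℝ V]
    [MeasurableSpace V] [BorelSpace V] [HasContDiffBump V] [Nontrivial V]
    (ν : Measure V) [ν.IsAddHaarMeasure]
    [NormedAddCommGroup E] [InnerProductSpace ℝ E] [FiniteDimensional ℝ E]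
    [MeasurableSpace E] [BorelSpace E] (μ : Measure E) [μ.IsAddHaarMeasure]
    (φ : E → ℝ) (hφ : ContDiff ℝ (⊤ : ℕ∞) φ) (A W : V →L[ℝ] E) (c : ℝ) (hc : 0 < c)
    (K : Set E) (hK : IsCompact K) (hKc : Convex ℝ K)
    (hpos : ∀ ξ ∈ K, ∀ ω : V, ‖ω‖ = 1 → c ≤ fderiv ℝ (fderiv ℝ φ) ξ (A ω) (W ω))
    (η : E → ℂ) (hη : ContDiff ℝ (⊤ : ℕ∞) η) (hη0 : ∀ ξ, ξ ∉ K → η ξ = 0)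
    (k : ℕ) (hk : Module.finrank ℝ V = k) :
    ∃ C, 0 ≤ C ∧ ∀ (x : E) (t : ℝ),
      ‖∫ ξ, Complex.exp (Complex.I * ((inner ℝ x ξ + t * φ ξ : ℝ) : ℂ)) * η ξ ∂μ‖ ≤
        C * (1 + Real.sqrt (‖x‖ ^ 2 + t ^ 2)) ^ (-(k : ℝ) / 2) := by
  obtain ⟨C1, hC1, H1⟩ := sp_local ν μ φ hφ A W c hc K hK hKc hpos η hη hη0
  obtain ⟨B, C2, hB, hC2, H2⟩ := sp_large μ φ hφ k K hK η hη hη0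
  set C0 := ∫ ξ, ‖η ξ‖ ∂μ with hC0
  have hC00 : 0 ≤ C0 := integral_nonneg fun _ => norm_nonneg _
  set S := C0 ^ 2 * (B + 2) ^ k + C1 * (B + 2) ^ k + C2 ^ 2 * (1 + B⁻¹) ^ k with hS
  have hS0 : 0 ≤ S := by positivity
  refine ⟨Real.sqrt S, Real.sqrt_nonneg _, ?_⟩
  intro x t
  set I := ‖∫ ξ, Complex.exp (Complex.I * ((inner ℝ x ξ + t * φ ξ : ℝ) : ℂ)) * η ξ ∂μ‖ with hI
  have hI0 : 0 ≤ I := norm_nonneg _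
  have hIC0 : I ≤ C0 := by
    refine (norm_integral_le_integral_norm _).trans_eq ?_
    congr 1
    ext ξ
    rw [norm_mul, mul_comm Complex.I, Complex.norm_exp_ofReal_mul_I, one_mul]
  set T := Real.sqrt (‖x‖ ^ 2 + t ^ 2) with hT
  have hT0 : 0 ≤ T := Real.sqrt_nonneg _
  have hT1 : T ≤ ‖x‖ + |t| := by
    rw [hT]
    apply Real.sqrt_le_iff.2
    refine ⟨by positivity, ?_⟩
    nlinarith [sq_abs t, mul_nonneg (norm_nonneg x) (abs_nonneg t)]
  refine sp_fin k I (1 + T) _ (by positivity) (Real.sqrt_nonneg _) ?_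
  rw [Real.sq_sqrt hS0]
  have p1 : 0 ≤ C0 ^ 2 * (B + 2) ^ k := by positivity
  have p2 : 0 ≤ C1 * (B + 2) ^ k := by positivity
  have p3 : 0 ≤ C2 ^ 2 * (1 + B⁻¹) ^ k := by positivity
  rcases le_or_gt T (B + 1) with hTB | hTB
  · have : I ^ 2 * (1 + T) ^ k ≤ C0 ^ 2 * (B + 2) ^ k :=
      mul_le_mul (pow_le_pow_left₀ hI0 hIC0 2) (pow_le_pow_left₀ (by positivity) (by linarith) k)
        (by positivity) (by positivity)
    linarith
  rcases lt_or_ge ‖x‖ (B * |t|) with hx | hx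
  · have ht1 : 1 ≤ |t| := by
      by_contra h
      push Not at h
      nlinarith
    have ht0 : t ≠ 0 := by
      intro h; rw [h] at ht1; simp at ht1; linarith
    have h := H1 (innerSL ℝ x) t ht0
    simp only [innerSL_apply_apply] at h
    rw [← hI, hk] at h
    have hY : 1 + T ≤ (B + 2) * |t| := by nlinarith
    have : I ^ 2 * (1 + T) ^ k ≤ C1 * (B + 2) ^ k := by
      calc I ^ 2 * (1 + T) ^ k ≤ (C1 * (|t| ^ k)⁻¹) * ((B + 2) * |t|) ^ k := by gcongr
        _ = C1 * (B + 2) ^ k * ((|t| ^ k)⁻¹ * |t| ^ k) := by rw [mul_pow]; ring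
        _ = _ := by rw [inv_mul_cancel₀ (by positivity), mul_one]
    linarith
  · have hx0 : x ≠ 0 := by
      intro h
      rw [h, norm_zero] at hx hT1
      have : |t| ≤ 0 := by
        by_contra h'
        push Not at h'
        nlinarith
      linarith
    have h := H2 x t hx0 hx
    rw [← hI] at h
    have ht : |t| ≤ B⁻¹ * ‖x‖ := by rw [inv_mul_eq_div, le_div_iff₀ hB]; linarith
    have hB' : 0 < B⁻¹ := inv_pos.2 hB
    have hY : 1 + T ≤ (1 + B⁻¹) * (1 + ‖x‖) := by nlinarith
    have : I ^ 2 * (1 + T) ^ k ≤ C2 ^ 2 * (1 + B⁻¹) ^ k := by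
      calc I ^ 2 * (1 + T) ^ k ≤ (C2 * ((1 + ‖x‖) ^ k)⁻¹) ^ 2 * ((1 + B⁻¹) * (1 + ‖x‖)) ^ k := by
            gcongr
        _ = C2 ^ 2 * (1 + B⁻¹) ^ k * (((1 + ‖x‖) ^ k)⁻¹ * (((1 + ‖x‖) ^ k)⁻¹ * (1 + ‖x‖) ^ k)) := by
            rw [mul_pow (1 + B⁻¹)]; ring
        _ = C2 ^ 2 * (1 + B⁻¹) ^ k * (((1 + ‖x‖) ^ k)⁻¹) := by
            rw [inv_mul_cancel₀ (by positivity), mul_one]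
        _ ≤ C2 ^ 2 * (1 + B⁻¹) ^ k * 1 := by
            gcongr
            apply inv_le_one_of_one_le₀
            apply one_le_pow₀
            linarith [norm_nonneg x]
        _ = _ := mul_one _
    linarith

theorem sp_point (n k : ℕ) (φ : EuclideanSpace ℝ (Fin n) → ℝ) (hφ : ContDiff ℝ (⊤ : ℕ∞) φ)
    (ξ₀ : EuclideanSpace ℝ (Fin n)) (hr : k ≤ (hessianMatrix n φ ξ₀).rank) :
    ∃ (A W : EuclideanSpace ℝ (Fin k) →L[ℝ] EuclideanSpace ℝ (Fin n)) (c δ : ℝ), 0 < c ∧ 0 < δ ∧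
      ∀ ξ ∈ Metric.closedBall ξ₀ δ, ∀ ω : EuclideanSpace ℝ (Fin k), ‖ω‖ = 1 →
        c ≤ fderiv ℝ (fderiv ℝ φ) ξ (A ω) (W ω) := by
  have h1 : ContDiff ℝ (⊤ : ℕ∞) (fderiv ℝ φ) := hφ.fderiv_right (by simp)
  have h2 : ContDiff ℝ (⊤ : ℕ∞) (fderiv ℝ (fderiv ℝ φ)) := h1.fderiv_right (by simp)
  set M := hessianMatrix n φ ξ₀ with hM
  set D := fderiv ℝ (fderiv ℝ φ) ξ₀ with hD
  have hMij : ∀ i j, M i j = D (EuclideanSpace.single j 1) (EuclideanSpace.single i 1) := by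
    intro i j
    have e2 : HasFDerivAt (fderiv ℝ φ) D ξ₀ := (h1.differentiable (by simp) _).hasFDerivAt
    have e4 := (ContinuousLinearMap.apply ℝ ℝ (EuclideanSpace.single i (1:ℝ))).hasFDerivAt.comp ξ₀ e2
    have e5 : fderiv ℝ (fun y => fderiv ℝ φ y (EuclideanSpace.single i (1 : ℝ))) ξ₀ = _ := e4.fderiv
    simp only [hM, hessianMatrix, Matrix.of_apply]
    rw [e5]
    simp
  set T := Matrix.toEuclideanLin M with hT
  have hsum : ∀ v : EuclideanSpace ℝ (Fin n), v = ∑ i, v i • EuclideanSpace.single i (1:ℝ) := by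
    intro v
    have := (EuclideanSpace.basisFun (Fin n) ℝ).sum_repr v
    simpa using this.symm
  have hTi : ∀ v i, T v i = D v (EuclideanSpace.single i 1) := by
    intro v i
    conv_rhs => rw [hsum v]
    simp only [hT, Matrix.toLpLin_apply, Matrix.mulVec, dotProduct, map_sum, map_smul,
      sum_apply, smul_apply, smul_eq_mul, hMij]
    exact Finset.sum_congr rfl fun j _ => mul_comm _ _
  have hTin : ∀ v w, D v w = inner ℝ (T v) w := by
    intro v w
    conv_lhs => rw [hsum w]
    simp only [map_sum, map_smul, smul_eq_mul, PiLp.inner_apply, hTi]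
    refine Finset.sum_congr rfl fun j _ => ?_
    simp
  have hrk : k ≤ Module.finrank ℝ (LinearMap.range T) := by
    rw [hT, Matrix.toEuclideanLin_eq_toLin, ← Matrix.rank_eq_finrank_range_toLin]
    exact hr
  obtain ⟨h, hh⟩ : ∃ h : EuclideanSpace ℝ (Fin k) →ₗ[ℝ] LinearMap.range T,
      Function.Injective h := by
    apply rank_le_iff_exists_linearMap.1
    rw [← Module.finrank_eq_rank, ← Module.finrank_eq_rank, finrank_euclideanSpace_fin]
    exact_mod_cast hrk
  obtain ⟨g, hg⟩ := T.rangeRestrict.exists_rightInverse_of_surjective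
    (LinearMap.range_eq_top.2 T.surjective_rangeRestrict)
  have hTA : ∀ v, T (g (h v)) = (h v : EuclideanSpace ℝ (Fin n)) := by
    intro v
    have := DFunLike.congr_fun hg (h v)
    exact congrArg Subtype.val this
  have hker : LinearMap.ker (T ∘ₗ g ∘ₗ h) = ⊥ := by
    rw [LinearMap.ker_eq_bot]
    intro u v huv
    simp only [LinearMap.comp_apply, hTA] at huv
    exact hh (Subtype.ext huv)
  obtain ⟨κ, hκ, hanti⟩ := (T ∘ₗ g ∘ₗ h).exists_antilipschitzWith hker
  set A := LinearMap.toContinuousLinearMap (g ∘ₗ h) with hA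
  set W := LinearMap.toContinuousLinearMap (T ∘ₗ g ∘ₗ h) with hW
  have hWA : ∀ v, W v = T (A v) := fun v => rfl
  have hlow : ∀ ω, ‖ω‖ = 1 → (κ : ℝ)⁻¹ ≤ ‖W ω‖ := by
    intro ω hω
    have := hanti.le_mul_dist ω 0
    rw [map_zero, dist_zero_right, dist_zero_right, hω] at this
    rw [inv_le_iff_one_le_mul₀ (by exact_mod_cast hκ), mul_comm]
    exact this
  have hκ' : (0:ℝ) < (κ : ℝ)⁻¹ := inv_pos.2 (by exact_mod_cast hκ)
  set c := ((κ : ℝ)⁻¹) ^ 2 / 2 with hc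
  have hc0 : 0 < c := by positivity
  have hcont := h2.continuous.continuousAt (x := ξ₀)
  obtain ⟨δ, hδ, Hδ⟩ := Metric.continuousAt_iff.1 hcont (c / (‖A‖ * ‖W‖ + 1)) (by positivity)
  refine ⟨A, W, c, δ / 2, hc0, by positivity, ?_⟩
  intro ξ hξ ω hω
  have hd : dist ξ ξ₀ < δ := by
    have : dist ξ ξ₀ ≤ δ / 2 := hξ
    linarith
  have k1 := (Hδ hd).le
  rw [dist_eq_norm] at k1
  set D' := fderiv ℝ (fderiv ℝ φ) ξ
  have k2 : |(D' - D) (A ω) (W ω)| ≤ c := by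
    have e1 := (D' - D).le_opNorm₂ (A ω) (W ω)
    have e2 := A.le_opNorm ω
    have e3 := W.le_opNorm ω
    rw [hω, mul_one] at e2 e3
    rw [Real.norm_eq_abs] at e1
    calc _ ≤ ‖D' - D‖ * ‖A ω‖ * ‖W ω‖ := e1
      _ ≤ (c / (‖A‖ * ‖W‖ + 1)) * ‖A‖ * ‖W‖ := by gcongr
      _ = c * ((‖A‖ * ‖W‖) / (‖A‖ * ‖W‖ + 1)) := by ring
      _ ≤ c * 1 := by
        gcongr
        rw [div_le_one (by positivity)]
        linarith
      _ = c := mul_one c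
  have k3 : D (A ω) (W ω) = ‖W ω‖ ^ 2 := by
    rw [hTin, ← hWA, real_inner_self_eq_norm_sq]
  have k4 : ((κ : ℝ)⁻¹) ^ 2 ≤ ‖W ω‖ ^ 2 := by
    have := hlow ω hω
    gcongr
  have k5 : (D' - D) (A ω) (W ω) = D' (A ω) (W ω) - D (A ω) (W ω) := by simp
  have := (abs_le.1 k2).1
  rw [k5, k3] at this
  have : ((κ : ℝ)⁻¹) ^ 2 = 2 * c := by rw [hc]; ring
  linarith

theorem sp_cut (n : ℕ) (φ : EuclideanSpace ℝ (Fin n) → ℝ) (S U : Set (EuclideanSpace ℝ (Fin n)))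
    (hS : IsClosed S) (hU : IsOpen U) (hSU : S ⊆ U) (hφ : ContDiffOn ℝ (⊤ : ℕ∞) φ U) :
    ∃ ψ : EuclideanSpace ℝ (Fin n) → ℝ, ContDiff ℝ (⊤ : ℕ∞) ψ ∧ ∀ ξ ∈ S, ψ =ᶠ[nhds ξ] φ := by
  obtain ⟨f, h0, h1, -⟩ := exists_contMDiffMap_zero_one_nhds_of_isClosed
    (n := (⊤ : ℕ∞)) (modelWithCornersSelf ℝ (EuclideanSpace ℝ (Fin n)))
    (s := Uᶜ) (t := S) hU.isClosed_compl hS (by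
      rw [Set.disjoint_left]; intro x hx hx'; exact hx (hSU hx'))
  have hf : ContDiff ℝ (⊤ : ℕ∞) f := f.contMDiff.contDiff
  refine ⟨fun x => f x * φ x, ?_, ?_⟩
  · rw [contDiff_iff_contDiffAt]
    intro x
    by_cases hx : x ∈ U
    · exact hf.contDiffAt.mul (hφ.contDiffAt (hU.mem_nhds hx))
    · have h2 : ∀ᶠ y in nhds x, f y = 0 := Filter.Eventually.filter_mono (nhds_le_nhdsSet hx) h0
      refine (contDiffAt_const (c := (0:ℝ))).congr_of_eventuallyEq ?_
      filter_upwards [h2] with y hy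
      simp [hy]
  · intro ξ hξ
    have h2 : ∀ᶠ y in nhds ξ, f y = 1 := Filter.Eventually.filter_mono (nhds_le_nhdsSet hξ) h1
    filter_upwards [h2] with y hy
    simp [hy]

/-- stationary phase bound. If `η ∈ C_c^∞(ℝⁿ)` and `φ` is smooth on a
neighborhood of `supp η` with Hessian of rank `≥ k` on `supp η`, then
`|∫ e^{i(x·ξ + tφ(ξ))} η(ξ) dξ| ≤ C (1+|(x,t)|)^{-k/2}`. -/
theorem stationary_phase (n k : ℕ) (η : EuclideanSpace ℝ (Fin n) → ℂ)
    (φ : EuclideanSpace ℝ (Fin n) → ℝ)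
    (hη : ContDiff ℝ (⊤ : ℕ∞) η) (hηc : HasCompactSupport η)
    (hφ : ∃ U : Set (EuclideanSpace ℝ (Fin n)),
      IsOpen U ∧ tsupport η ⊆ U ∧ ContDiffOn ℝ (⊤ : ℕ∞) φ U)
    (hrank : ∀ ξ ∈ tsupport η, k ≤ (hessianMatrix n φ ξ).rank) :
    ∃ C > 0, ∀ (x : EuclideanSpace ℝ (Fin n)) (t : ℝ),
      ‖∫ ξ : EuclideanSpace ℝ (Fin n),
          Complex.exp (Complex.I * (((∑ i, x i * ξ i) + t * φ ξ : ℝ) : ℂ)) * η ξ‖ ≤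
        C * (1 + Real.sqrt (‖x‖ ^ 2 + t ^ 2)) ^ (-(k : ℝ) / 2) := by
  rcases Nat.eq_zero_or_pos k with rfl | hk
  · refine ⟨(∫ ξ, ‖η ξ‖) + 1, by positivity, ?_⟩
    intro x t
    simp only [Nat.cast_zero, neg_zero, zero_div, Real.rpow_zero, mul_one]
    refine (norm_integral_le_integral_norm _).trans ?_
    have : ∀ ξ, ‖Complex.exp (Complex.I * (((∑ i, x i * ξ i) + t * φ ξ : ℝ) : ℂ)) * η ξ‖
        = ‖η ξ‖ := by
      intro ξ
      rw [norm_mul, mul_comm Complex.I, Complex.norm_exp_ofReal_mul_I, one_mul]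
    simp only [this]
    linarith
  obtain ⟨U, hU, hSU, hφU⟩ := hφ
  obtain ⟨ψ, hψ, hψφ⟩ := sp_cut n φ (tsupport η) U (isClosed_tsupport η) hU hSU hφU
  have hrank' : ∀ ξ ∈ tsupport η, k ≤ (hessianMatrix n ψ ξ).rank := by
    intro ξ hξ
    have : hessianMatrix n ψ ξ = hessianMatrix n φ ξ := by
      ext i j
      simp only [hessianMatrix, Matrix.of_apply]
      have e : (fun y => fderiv ℝ ψ y (EuclideanSpace.single i (1:ℝ))) =ᶠ[nhds ξ]
          (fun y => fderiv ℝ φ y (EuclideanSpace.single i (1:ℝ))) := by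
        filter_upwards [(hψφ ξ hξ).fderiv (𝕜 := ℝ)] with y hy
        rw [hy]
      rw [e.fderiv_eq]
    rw [this]; exact hrank ξ hξ
  have hpt := fun ξ₀ : tsupport η => sp_point n k ψ hψ ξ₀ (hrank' ξ₀ ξ₀.2)
  choose A W c δ hc hδ hpos using hpt
  have : Nonempty (Fin k) := ⟨⟨0, hk⟩⟩
  -- finite cover
  obtain ⟨F, hF⟩ := hηc.isCompact.elim_finite_subcover
    (fun ξ₀ : tsupport η => Metric.ball (ξ₀ : EuclideanSpace ℝ (Fin n)) (δ ξ₀ / 2))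
    (fun _ => Metric.isOpen_ball) (by
      intro ξ hξ
      exact mem_iUnion.2 ⟨⟨ξ, hξ⟩, Metric.mem_ball_self (half_pos (hδ _))⟩)
  let ρ : ∀ ξ₀ : tsupport η, ContDiffBump (ξ₀ : EuclideanSpace ℝ (Fin n)) := fun ξ₀ =>
    ⟨δ ξ₀ / 2, δ ξ₀, half_pos (hδ _), half_lt_self (hδ _)⟩
  obtain ⟨θ, hθ, hθ1⟩ := sp_theta 1 one_pos
  set σ : EuclideanSpace ℝ (Fin n) → ℝ := fun ξ => ∑ i ∈ F, ρ i ξ with hσ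
  have hσs : ContDiff ℝ (⊤ : ℕ∞) σ := ContDiff.sum fun i _ => (ρ i).contDiff
  have hσ1 : ∀ ξ ∈ tsupport η, 1 ≤ σ ξ := by
    intro ξ hξ
    obtain ⟨i, hi, hξi⟩ := mem_iUnion₂.1 (hF hξ)
    have : ρ i ξ = 1 := (ρ i).one_of_mem_closedBall (Metric.ball_subset_closedBall hξi)
    rw [← this]
    exact Finset.single_le_sum (f := fun i => ρ i ξ) (fun j _ => (ρ j).nonneg) hi
  set p : tsupport η → EuclideanSpace ℝ (Fin n) → ℂ := fun i ξ =>
    ((ρ i ξ * θ (σ ξ) : ℝ) : ℂ) * η ξ with hp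
  have hps : ∀ i, ContDiff ℝ (⊤ : ℕ∞) (p i) := fun i =>
    (Complex.ofRealCLM.contDiff.comp ((ρ i).contDiff.mul (hθ.comp hσs))).mul hη
  have hp0 : ∀ (i : tsupport η) (ξ), ξ ∉ Metric.closedBall (i : EuclideanSpace ℝ (Fin n)) (δ i) → p i ξ = 0 := by
    intro i ξ hξ
    have : ρ i ξ = 0 := by
      apply (ρ i).zero_of_le_dist
      simp only [Metric.mem_closedBall, not_le] at hξ
      exact hξ.le
    simp [hp, this]
  have hpsum : ∀ ξ, ∑ i ∈ F, p i ξ = η ξ := by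
    intro ξ
    by_cases hξ : ξ ∈ tsupport η
    · simp only [hp]
      rw [← Finset.sum_mul, ← Complex.ofReal_sum, ← Finset.sum_mul]
      have := hθ1 _ (hσ1 ξ hξ)
      rw [mul_comm] at this
      change ((σ ξ * θ (σ ξ) : ℝ) : ℂ) * η ξ = η ξ
      rw [this]; simp
    · simp [hp, image_eq_zero_of_notMem_tsupport hξ]
  have hpiece := fun i : tsupport η => sp_piece
    (volume : Measure (EuclideanSpace ℝ (Fin k))) (volume : Measure (EuclideanSpace ℝ (Fin n)))
    ψ hψ (A i) (W i) (c i) (hc i) (Metric.closedBall (i : EuclideanSpace ℝ (Fin n)) (δ i))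
    (isCompact_closedBall _ _) (convex_closedBall _ _) (hpos i) (p i) (hps i) (hp0 i) k (by simp)
  choose C hC H using hpiece
  have hC' : 0 ≤ ∑ i ∈ F, C i := Finset.sum_nonneg fun i _ => hC i
  refine ⟨∑ i ∈ F, C i + 1, by positivity, ?_⟩
  intro x t
  have e1 : ∀ ξ, Complex.exp (Complex.I * (((∑ i, x i * ξ i) + t * φ ξ : ℝ) : ℂ)) * η ξ =
      ∑ i ∈ F, Complex.exp (Complex.I * ((inner ℝ x ξ + t * ψ ξ : ℝ) : ℂ)) * p i ξ := by
    intro ξ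
    rw [← Finset.mul_sum, hpsum]
    by_cases hξ : ξ ∈ tsupport η
    · rw [(hψφ ξ hξ).self_of_nhds]
      have : inner ℝ x ξ = ∑ i, x i * ξ i := by
        simp [PiLp.inner_apply, mul_comm]
      rw [this]
    · simp [image_eq_zero_of_notMem_tsupport hξ]
  simp only [e1]
  rw [integral_finsetSum]
  · refine (norm_sum_le _ _).trans ((Finset.sum_le_sum fun i _ => H i x t).trans ?_)
    rw [← Finset.sum_mul]
    refine mul_le_mul_of_nonneg_right (by linarith) ?_
    positivity
  · intro i _
    have h1 := hψ.continuous
    have h2 := (hps i).continuous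
    refine Continuous.integrable_of_hasCompactSupport ?_ (HasCompactSupport.intro
      (isCompact_closedBall (i : EuclideanSpace ℝ (Fin n)) (δ i)) ?_)
    · fun_prop
    · intro ξ hξ
      rw [hp0 i ξ hξ, mul_zero]

end
end

section
/- For the indicator weight $w=\chi_B$ with $B=\{(x,t):|t|\leq\frac{1}{4n},|x_1-2Mt|\leq\frac{1}{4n},|x_k|\leq\frac{1}{4n}\}$, $M\geq1$, one has the two-sided bound $\|\chi_B\|_{\mathfrak{L}^{\alpha,p}_2}\sim\max\{M^{-\alpha/2},\,M^{-1/p},\,M^{\alpha-(n+2)/p}\}$ with implicit constants independent of $M$ (for $\alpha>0$, $1\leq p\leq\frac{n+2}{\alpha}$). -/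
open MeasureTheory Set
open scoped ENNReal

noncomputable section

/-- The cube in `ℝⁿ` centered at `x` with side length `r`. -/
def cube (n : ℕ) (x : EuclideanSpace ℝ (Fin n)) (r : ℝ) : Set (EuclideanSpace ℝ (Fin n)) :=
  {y | ∀ i, |y i - x i| ≤ r / 2}

/-- The anisotropic Morrey–Campanato norm `‖w‖_{𝔏^{α,p}_γ}` on `ℝ^{n+1}`. -/
def MCnorm (n : ℕ) (γ α p : ℝ) (w : EuclideanSpace ℝ (Fin n) → ℝ → ℝ) : ℝ≥0∞ :=
  ⨆ (x : EuclideanSpace ℝ (Fin n)) (t : ℝ) (r : ℝ) (_ : 0 < r),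
    ENNReal.ofReal (r ^ α *
      (r ^ (-((n : ℝ) + γ)) *
        ∫ y in cube n x r, ∫ s in Icc (t - r ^ γ / 2) (t + r ^ γ / 2), w y s ^ p) ^ (1 / p))

/-- The tube `B = {(x,t) : |t| ≤ 1/(4n), |x₁ - 2Mt| ≤ 1/(4n), |x_k| ≤ 1/(4n) (k ≥ 2)}`. -/
def tubeB (n : ℕ) (hn : 0 < n) (M : ℝ) : Set (EuclideanSpace ℝ (Fin n) × ℝ) :=
  {p | |p.2| ≤ 1 / (4 * n) ∧ |p.1 ⟨0, hn⟩ - 2 * M * p.2| ≤ 1 / (4 * n) ∧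
    ∀ i : Fin n, i ≠ ⟨0, hn⟩ → |p.1 i| ≤ 1 / (4 * n)}


def bx (n : ℕ) (l d : Fin n → ℝ) : Set (EuclideanSpace ℝ (Fin n)) :=
  {y | ∀ i, l i ≤ y i ∧ y i ≤ l i + d i}

lemma bx_eq (n : ℕ) (l d : Fin n → ℝ) :
    bx n l d = (WithLp.ofLp : EuclideanSpace ℝ (Fin n) → _) ⁻¹' (Icc l (l + d)) := by
  ext y
  simp [bx, Pi.le_def, forall_and]

lemma bx_meas (n : ℕ) (l d : Fin n → ℝ) : MeasurableSet (bx n l d) := by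
  rw [bx_eq]
  exact (EuclideanSpace.volume_preserving_symm_measurableEquiv_toLp (Fin n)).measurable measurableSet_Icc

lemma bx_vol (n : ℕ) (l d : Fin n → ℝ) : volume (bx n l d) = ∏ i, ENNReal.ofReal (d i) := by
  rw [bx_eq]
  have := (EuclideanSpace.volume_preserving_symm_measurableEquiv_toLp (Fin n)).measure_preimage
    (measurableSet_Icc (a := l) (b := l + d)).nullMeasurableSet
  rw [Real.volume_Icc_pi] at this
  refine Eq.trans ?_ (this.trans ?_)
  · rfl
  · simp

lemma bx_real (n : ℕ) (l d : Fin n → ℝ) (hd : ∀ i, 0 ≤ d i) : volume.real (bx n l d) = ∏ i, d i := by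
  rw [Measure.real, bx_vol, ENNReal.toReal_prod]
  exact Finset.prod_congr rfl fun i _ => ENNReal.toReal_ofReal (hd i)

lemma prod_d (n : ℕ) (hn : 0 < n) (a b : ℝ) :
    ∏ i : Fin n, (if i = ⟨0, hn⟩ then a else b) = a * b ^ (n - 1) := by
  obtain ⟨m, rfl⟩ : ∃ m, n = m + 1 := ⟨n - 1, by omega⟩
  rw [Fin.prod_univ_succ]
  have h0 : (⟨0, hn⟩ : Fin (m+1)) = 0 := rfl
  simp [h0]

lemma cube_eq (n : ℕ) (x : EuclideanSpace ℝ (Fin n)) (r : ℝ) :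
    cube n x r = bx n (fun i => x i - r / 2) (fun _ => r) := by
  ext y
  simp only [cube, bx, mem_ofPred_eq, abs_le]
  refine forall_congr' fun i => ⟨fun h => ⟨?_, ?_⟩, fun h => ⟨?_, ?_⟩⟩ <;> linarith [h.1, h.2]

lemma tube_meas (n : ℕ) (hn : 0 < n) (M : ℝ) : MeasurableSet (tubeB n hn M) := by
  have hc : ∀ i, Continuous fun p : EuclideanSpace ℝ (Fin n) × ℝ => p.1 i := fun i => by fun_prop
  have : IsClosed (tubeB n hn M) := by
    unfold tubeB
    simp only [ofPred_and, ofPred_forall]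
    refine (isClosed_le (by fun_prop) (by fun_prop)).inter
      ((isClosed_le (by fun_prop) (by fun_prop)).inter
        (isClosed_iInter fun i => isClosed_iInter fun _ => isClosed_le (hc i).abs (by fun_prop)))
  exact this.measurableSet

/-- inner integral -/
def gI (n : ℕ) (hn : 0 < n) (M t r : ℝ) (y : EuclideanSpace ℝ (Fin n)) : ℝ :=
  ∫ s in Icc (t - r ^ (2:ℝ) / 2) (t + r ^ (2:ℝ) / 2),
    (tubeB n hn M).indicator (fun _ => (1 : ℝ)) (y, s)

lemma ind_le (n : ℕ) (hn : 0 < n) (M : ℝ) (z) :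
    ‖(tubeB n hn M).indicator (fun _ => (1 : ℝ)) z‖ ≤ 1 := by
  by_cases h : z ∈ tubeB n hn M <;> simp [h]

lemma ind_nn (n : ℕ) (hn : 0 < n) (M : ℝ) (z) :
    0 ≤ (tubeB n hn M).indicator (fun _ => (1 : ℝ)) z := by
  by_cases h : z ∈ tubeB n hn M <;> simp [h]

lemma gI_nn (n : ℕ) (hn : 0 < n) (M t r : ℝ) (y) : 0 ≤ gI n hn M t r y :=
  integral_nonneg fun _ => ind_nn n hn M _

lemma gI_sm (n : ℕ) (hn : 0 < n) (M t r : ℝ) : StronglyMeasurable (gI n hn M t r) := by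
  have : StronglyMeasurable (fun z : EuclideanSpace ℝ (Fin n) × ℝ =>
      (tubeB n hn M).indicator (fun _ => (1 : ℝ)) z) :=
    stronglyMeasurable_const.indicator (tube_meas n hn M)
  exact this.integral_prod_right'

lemma gI_upper (n : ℕ) (hn : 0 < n) (M t r : ℝ) (y) (u δ : ℝ) (hδ : 0 ≤ δ)
    (h : ∀ s ∈ Icc (t - r ^ (2:ℝ) / 2) (t + r ^ (2:ℝ) / 2), (y, s) ∈ tubeB n hn M →
      s ∈ Icc u (u + δ)) : gI n hn M t r y ≤ δ := by
  have e : gI n hn M t r y = ∫ s in Icc (t - r ^ (2:ℝ) / 2) (t + r ^ (2:ℝ) / 2) ∩ Icc u (u + δ),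
      (tubeB n hn M).indicator (fun _ => (1 : ℝ)) (y, s) := by
    refine setIntegral_eq_of_subset_of_forall_sdiff_eq_zero measurableSet_Icc inter_subset_left ?_
    intro s hs
    refine indicator_of_notMem (fun hB => hs.2 ⟨hs.1, h s hs.1 hB⟩) _
  have hv : volume.real (Icc (t - r ^ (2:ℝ) / 2) (t + r ^ (2:ℝ) / 2) ∩ Icc u (u + δ)) ≤ δ := by
    refine (measureReal_mono inter_subset_right (by simp)).trans ?_
    simp [Real.volume_real_Icc, hδ]
  rw [e]
  refine (le_abs_self _).trans ?_
  rw [← Real.norm_eq_abs]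
  refine (norm_setIntegral_le_of_norm_le_const (C := 1) ?_ fun s _ => ind_le n hn M _).trans ?_
  · exact (measure_mono inter_subset_right).trans_lt (by simp)
  · simpa using hv

lemma gI_lower (n : ℕ) (hn : 0 < n) (M t r : ℝ) (y) (u δ : ℝ) (hδ : 0 ≤ δ)
    (h : ∀ s ∈ Icc u (u + δ), s ∈ Icc (t - r ^ (2:ℝ) / 2) (t + r ^ (2:ℝ) / 2) ∧
      (y, s) ∈ tubeB n hn M) : δ ≤ gI n hn M t r y := by
  have hm : Measurable (fun s : ℝ => (tubeB n hn M).indicator (fun _ => (1 : ℝ)) (y, s)) :=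
    (measurable_const.indicator (tube_meas n hn M)).comp measurable_prodMk_left
  have h1 : ∫ s in Icc u (u + δ), (tubeB n hn M).indicator (fun _ => (1 : ℝ)) (y, s) = δ := by
    rw [setIntegral_congr_fun (g := fun _ => (1:ℝ)) measurableSet_Icc
      (fun s hs => indicator_of_mem (h s hs).2 _)]
    simp [Real.volume_real_Icc, hδ]
  rw [← h1]
  refine setIntegral_mono_set ?_ ?_ ?_
  · exact Measure.integrableOn_of_bounded (M := 1) (by simp) hm.aestronglyMeasurable
      (Filter.Eventually.of_forall fun s => ind_le n hn M _)
  · exact Filter.Eventually.of_forall fun s => ind_nn n hn M _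
  · exact Filter.Eventually.of_forall fun s hs => (h s hs).1

lemma gI_le (n : ℕ) (hn : 0 < n) (M t r : ℝ) (y) : gI n hn M t r y ≤ r ^ 2 := by
  refine gI_upper n hn M t r y (t - r^2/2) (r^2) (by positivity) fun s hs _ => ?_
  simp only [Real.rpow_two] at hs
  exact ⟨hs.1, by linarith [hs.2]⟩

lemma cube_fin (n : ℕ) (x : EuclideanSpace ℝ (Fin n)) (r : ℝ) : volume (cube n x r) < ⊤ := by
  rw [cube_eq, bx_vol]
  exact ENNReal.prod_lt_top fun i _ => by simp

lemma I_upper (n : ℕ) (hn : 0 < n) (M t r : ℝ) (x) (l : Fin n → ℝ) (d0 d δ : ℝ) (hd0 : 0 ≤ d0)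
    (hd : 0 ≤ d) (hg : ∀ y, gI n hn M t r y ≤ δ)
    (h : ∀ y ∈ cube n x r, ∀ s, (y, s) ∈ tubeB n hn M →
      y ∈ bx n l (fun i => if i = ⟨0, hn⟩ then d0 else d)) :
    ∫ y in cube n x r, gI n hn M t r y ≤ δ * (d0 * d ^ (n - 1)) := by
  set b := bx n l (fun i => if i = ⟨0, hn⟩ then d0 else d) with hb
  have hdd : ∀ i : Fin n, 0 ≤ (if i = ⟨0, hn⟩ then d0 else d) := by
    intro i; split_ifs <;> assumption
  have hfin : volume b < ⊤ := by
    rw [hb, bx_vol]; exact ENNReal.prod_lt_top fun i _ => by simp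
  have hδ : 0 ≤ δ := (gI_nn n hn M t r x).trans (hg x)
  have e : ∫ y in cube n x r, gI n hn M t r y = ∫ y in cube n x r ∩ b, gI n hn M t r y := by
    refine setIntegral_eq_of_subset_of_forall_sdiff_eq_zero (by rw [cube_eq]; exact bx_meas _ _ _)
      inter_subset_left ?_
    intro y hy
    unfold gI
    refine integral_eq_zero_of_ae (Filter.Eventually.of_forall fun s => ?_)
    exact indicator_of_notMem (fun hB => hy.2 ⟨hy.1, h y hy.1 s hB⟩) _
  rw [e]
  refine (le_abs_self _).trans ?_
  rw [← Real.norm_eq_abs]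
  refine (norm_setIntegral_le_of_norm_le_const (C := δ) ?_ fun y _ => ?_).trans ?_
  · exact (measure_mono inter_subset_right).trans_lt hfin
  · rw [Real.norm_eq_abs, abs_of_nonneg (gI_nn _ _ _ _ _ _)]; exact hg y
  · refine mul_le_mul_of_nonneg_left ?_ hδ
    refine (measureReal_mono inter_subset_right hfin.ne).trans ?_
    rw [hb, bx_real _ _ _ hdd, prod_d]

lemma I_lower (n : ℕ) (hn : 0 < n) (M t r : ℝ) (x) (l : Fin n → ℝ) (d0 d δ : ℝ) (hd0 : 0 ≤ d0)
    (hd : 0 ≤ d)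
    (h : ∀ y ∈ bx n l (fun i => if i = ⟨0, hn⟩ then d0 else d), y ∈ cube n x r ∧
      δ ≤ gI n hn M t r y) :
    δ * (d0 * d ^ (n - 1)) ≤ ∫ y in cube n x r, gI n hn M t r y := by
  set b := bx n l (fun i => if i = ⟨0, hn⟩ then d0 else d) with hb
  have hdd : ∀ i : Fin n, 0 ≤ (if i = ⟨0, hn⟩ then d0 else d) := by
    intro i; split_ifs <;> assumption
  have hfin : volume b < ⊤ := by
    rw [hb, bx_vol]; exact ENNReal.prod_lt_top fun i _ => by simp
  have hint : IntegrableOn (gI n hn M t r) (cube n x r) := by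
    refine Measure.integrableOn_of_bounded (M := r^2) (cube_fin _ _ _).ne
      (gI_sm n hn M t r).aestronglyMeasurable (Filter.Eventually.of_forall fun s => ?_)
    rw [Real.norm_eq_abs, abs_of_nonneg (gI_nn _ _ _ _ _ _)]; exact gI_le _ _ _ _ _ _
  have h1 : ∫ y in b, gI n hn M t r y ≤ ∫ y in cube n x r, gI n hn M t r y :=
    setIntegral_mono_set hint (Filter.Eventually.of_forall fun s => gI_nn _ _ _ _ _ _)
      (Filter.Eventually.of_forall fun s hs => (h s hs).1)
  refine le_trans ?_ h1
  have h2 : ∫ y in b, δ ≤ ∫ y in b, gI n hn M t r y :=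
    setIntegral_mono_on (integrableOn_const hfin.ne) (hint.mono_set fun s hs => (h s hs).1)
      (bx_meas _ _ _) fun y hy => (h y hy).2
  refine le_trans (le_of_eq ?_) h2
  rw [setIntegral_const, hb, bx_real _ _ _ hdd, prod_d, smul_eq_mul, mul_comm]

lemma MC_eq (n : ℕ) (hn : 0 < n) (α p M : ℝ) (hp : 1 ≤ p) :
    MCnorm n 2 α p (fun y s => (tubeB n hn M).indicator (fun _ => (1 : ℝ)) (y, s)) =
    ⨆ (x : EuclideanSpace ℝ (Fin n)) (t : ℝ) (r : ℝ) (_ : 0 < r),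
    ENNReal.ofReal (r ^ α *
      (r ^ (-((n : ℝ) + 2)) * ∫ y in cube n x r, gI n hn M t r y) ^ (1 / p)) := by
  have : ∀ z, (tubeB n hn M).indicator (fun _ => (1 : ℝ)) z ^ p =
      (tubeB n hn M).indicator (fun _ => (1 : ℝ)) z := by
    intro z
    by_cases h : z ∈ tubeB n hn M
    · simp [h]
    · simp [h, Real.zero_rpow (by linarith : p ≠ 0)]
  unfold MCnorm gI
  simp only [this]


lemma V_eq (N α p k r M a b : ℝ) (hk : 0 ≤ k) (hr : 0 < r) (hM : 0 < M) :
    r ^ α * (r ^ (-N) * (k * r ^ a * M ^ b)) ^ (1 / p) =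
      k ^ (1 / p) * r ^ (α + (a - N) / p) * M ^ (b / p) := by
  have : r ^ (-N) * (k * r ^ a * M ^ b) = k * r ^ (a - N) * M ^ b := by
    rw [sub_eq_add_neg, Real.rpow_add hr]; ring
  rw [this, Real.mul_rpow (by positivity) (by positivity), Real.mul_rpow hk (by positivity),
    ← Real.rpow_mul hr.le, ← Real.rpow_mul hM.le, Real.rpow_add hr]
  simp only [mul_one_div]
  ring

lemma V_mono (N α p r I J : ℝ) (hp : 1 ≤ p) (hr : 0 < r) (hI : 0 ≤ I) (h : I ≤ J) :
    r ^ α * (r ^ (-N) * I) ^ (1 / p) ≤ r ^ α * (r ^ (-N) * J) ^ (1 / p) := by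
  gcongr

lemma rpow_between (M r u v e : ℝ) (hM : 1 ≤ M) (h1 : M ^ u ≤ r) (h2 : r ≤ M ^ v) :
    r ^ e ≤ max (M ^ (u * e)) (M ^ (v * e)) := by
  have hM0 : 0 < M := by linarith
  have hu : 0 < M ^ u := by positivity
  rw [Real.rpow_mul hM0.le, Real.rpow_mul hM0.le]
  rcases le_total 0 e with he | he
  · exact le_max_of_le_right (Real.rpow_le_rpow (hu.le.trans h1) h2 he)
  · exact le_max_of_le_left (Real.rpow_le_rpow_of_nonpos hu h1 he)

lemma gI_le' (n : ℕ) (hn : 0 < n) (M t r : ℝ) (hM : 1 ≤ M) (y) : gI n hn M t r y ≤ M⁻¹ := by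
  have hM0 : 0 < M := by linarith
  have hn1 : (1:ℝ) ≤ n := by exact_mod_cast hn
  have ha : 1 / (4 * (n:ℝ)) ≤ 1 / 4 := by
    apply one_div_le_one_div_of_le <;> linarith
  refine gI_upper n hn M t r y (y ⟨0, hn⟩ / (2 * M) - M⁻¹ / 2) M⁻¹ (by positivity) fun s _ hB => ?_
  obtain ⟨-, h2, -⟩ := hB
  simp only [abs_le] at h2
  have e1 : y ⟨0, hn⟩ / (2 * M) * (2 * M) = y ⟨0, hn⟩ := by field_simp
  have e2 : M⁻¹ * M = 1 := by field_simp
  constructor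
  · refine le_of_mul_le_mul_right ?_ (by positivity : 0 < 2 * M)
    nlinarith [h2.1, h2.2]
  · refine le_of_mul_le_mul_right ?_ (by positivity : 0 < 2 * M)
    nlinarith [h2.1, h2.2]

lemma upper (n : ℕ) (hn : 0 < n) (α p : ℝ) (hα : 0 < α) (hp : 1 ≤ p)
    (hp' : p ≤ ((n : ℝ) + 2) / α) (M : ℝ) (hM : 1 ≤ M) (x t r) (hr : 0 < r) :
    r ^ α * (r ^ (-((n : ℝ) + 2)) * ∫ y in cube n x r, gI n hn M t r y) ^ (1 / p) ≤
      2 * max (M ^ (-α / 2)) (max (M ^ (-1 / p)) (M ^ (α - ((n : ℝ) + 2) / p))) := by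
  have hM0 : 0 < M := by linarith
  have hp0 : 0 < p := by linarith
  have hn1 : (1:ℝ) ≤ n := by exact_mod_cast hn
  have ha : 1 / (4 * (n:ℝ)) ≤ 1 / 4 := by
    apply one_div_le_one_div_of_le <;> linarith
  set mx := max (M ^ (-α / 2)) (max (M ^ (-1 / p)) (M ^ (α - ((n : ℝ) + 2) / p))) with hmx
  have m1 : M ^ (-α / 2) ≤ mx := le_max_left _ _
  have m2 : M ^ (-1 / p) ≤ mx := (le_max_left _ _).trans (le_max_right _ _)
  have m3 : M ^ (α - ((n : ℝ) + 2) / p) ≤ mx := (le_max_right _ _).trans (le_max_right _ _)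
  have m0 : 0 ≤ mx := le_trans (by positivity) m1
  have hI0 : 0 ≤ ∫ y in cube n x r, gI n hn M t r y := integral_nonneg fun _ => gI_nn _ _ _ _ _ _
  have pn : r * r ^ (n - 1) = r ^ n := by
    rw [← pow_succ', Nat.sub_add_cancel hn]
  have cb : ∀ y ∈ cube n x r, ∀ s, (y, s) ∈ tubeB n hn M →
      y ∈ bx n (fun i => x i - r / 2) (fun i => if i = ⟨0, hn⟩ then r else r) := by
    intro y hy s _
    rw [cube_eq] at hy
    simpa using hy
  have key : ∀ k a b : ℝ, 1 ≤ k → k ≤ 2 →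
      (∫ y in cube n x r, gI n hn M t r y) ≤ k * r ^ a * M ^ b →
      r ^ (α + (a - ((n:ℝ) + 2)) / p) * M ^ (b / p) ≤ mx →
      r ^ α * (r ^ (-((n : ℝ) + 2)) * ∫ y in cube n x r, gI n hn M t r y) ^ (1 / p) ≤ 2 * mx := by
    intro k a b hk hk2 hI hv
    refine (V_mono _ α p r _ _ hp hr hI0 hI).trans ?_
    rw [V_eq _ _ _ _ _ _ _ _ (by linarith) hr hM0, mul_assoc]
    refine mul_le_mul ?_ hv (by positivity) (by norm_num)
    refine le_trans ?_ hk2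
    calc k ^ (1 / p) ≤ k ^ (1:ℝ) := Real.rpow_le_rpow_of_exponent_le hk (by
          rw [div_le_one hp0]; exact hp)
      _ = k := Real.rpow_one k
  rcases le_total r (M ^ (-(1/2):ℝ)) with h1 | h1
  · refine key 1 (n + 2) 0 le_rfl (by norm_num) ?_ ?_
    · refine (I_upper n hn M t r x _ r r (r ^ 2) hr.le hr.le (gI_le n hn M t r) cb).trans ?_
      rw [pn, Real.rpow_add hr]
      simp [mul_comm]
    · simp only [sub_self, zero_div, add_zero, Real.rpow_zero, mul_one]
      refine (Real.rpow_le_rpow hr.le h1 hα.le).trans ?_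
      rw [← Real.rpow_mul hM0.le]
      refine le_trans (le_of_eq ?_) m1
      congr 1; ring
  rcases le_total r 1 with h2 | h2
  · refine key 1 n (-1) le_rfl (by norm_num) ?_ ?_
    · refine (I_upper n hn M t r x _ r r (M⁻¹) hr.le hr.le (gI_le' n hn M t r hM) cb).trans ?_
      rw [pn, Real.rpow_neg_one]
      simp [mul_comm]
    · have := rpow_between M r (-(1/2)) 0 (α + (n - ((n:ℝ) + 2)) / p) hM h1 (by simpa using h2)
      refine (mul_le_mul_of_nonneg_right this (by positivity)).trans ?_
      rw [max_mul_of_nonneg _ _ (by positivity), ← Real.rpow_add hM0, ← Real.rpow_add hM0]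
      refine max_le (le_trans (le_of_eq ?_) m1) (le_trans (le_of_eq ?_) m2)
      · congr 1; field_simp; ring
      · congr 1; ring
  have small : ∀ y s, (y, s) ∈ tubeB n hn M → ∀ i, i ≠ ⟨0, hn⟩ → -(1/2) ≤ y i ∧ y i ≤ -(1/2) + 1 := by
    intro y s hB i hi
    have := abs_le.1 (hB.2.2 i hi)
    constructor <;> linarith [this.1, this.2]
  rcases le_total r M with h3 | h3
  · refine key 1 1 (-1) le_rfl (by norm_num) ?_ ?_
    · refine (I_upper n hn M t r x (fun i => if i = ⟨0, hn⟩ then x i - r / 2 else -(1/2)) r 1 (M⁻¹)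
        hr.le zero_le_one (gI_le' n hn M t r hM) ?_).trans ?_
      · intro y hy s hB i
        by_cases hi : i = ⟨0, hn⟩
        · simp only [if_pos hi]
          rw [cube_eq] at hy
          exact hy i
        · simp only [if_neg hi]
          exact small y s hB i hi
      · rw [Real.rpow_neg_one]
        simp [mul_comm]
    · have := rpow_between M r 0 1 (α + (1 - ((n:ℝ) + 2)) / p) hM (by simpa using h2) (by simpa using h3)
      refine (mul_le_mul_of_nonneg_right this (by positivity)).trans ?_
      rw [max_mul_of_nonneg _ _ (by positivity), ← Real.rpow_add hM0, ← Real.rpow_add hM0]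
      refine max_le (le_trans (le_of_eq ?_) m2) (le_trans (le_of_eq ?_) m3)
      · congr 1; ring
      · congr 1; ring
  · refine key 2 0 0 (by norm_num) le_rfl ?_ ?_
    · refine (I_upper n hn M t r x (fun i => if i = ⟨0, hn⟩ then -M else -(1/2)) (2 * M) 1 (M⁻¹)
        (by positivity) zero_le_one (gI_le' n hn M t r hM) ?_).trans ?_
      · intro y hy s hB i
        by_cases hi : i = ⟨0, hn⟩
        · simp only [if_pos hi]
          subst hi
          have b1 := abs_le.1 hB.1
          have b2 := abs_le.1 hB.2.1
          simp only at b1 b2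
          constructor
          · nlinarith [b1.1, b1.2, b2.1, b2.2]
          · nlinarith [b1.1, b1.2, b2.1, b2.2]
        · simp only [if_neg hi]
          exact small y s hB i hi
      · simp only [one_pow, Real.rpow_zero, mul_one]
        refine le_of_eq ?_
        field_simp
    · have he : α + (0 - ((n:ℝ) + 2)) / p = α - ((n : ℝ) + 2) / p := by ring
      rw [he, zero_div, Real.rpow_zero, mul_one]
      refine (Real.rpow_le_rpow_of_nonpos hM0 h3 ?_).trans m3
      rw [sub_nonpos, le_div_iff₀ hp0]
      rw [le_div_iff₀ hα] at hp'
      linarith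

lemma lower1 (n : ℕ) (hn : 0 < n) (α p : ℝ) (hp : 1 ≤ p) (M : ℝ) (hM : 1 ≤ M) :
    ∃ r : ℝ, 0 < r ∧ (1 / (4 * (n:ℝ))) ^ α * M ^ (-α / 2) ≤
      r ^ α * (r ^ (-((n : ℝ) + 2)) * ∫ y in cube n 0 r, gI n hn M 0 r y) ^ (1 / p) := by
  have hM0 : 0 < M := by linarith
  have hn1 : (1:ℝ) ≤ n := by exact_mod_cast hn
  set a := 1 / (4 * (n:ℝ)) with hadef
  have ha : a ≤ 1 / 4 := by
    apply one_div_le_one_div_of_le <;> linarith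
  have ha0 : 0 < a := by positivity
  set q := M ^ (-(1/2):ℝ) with hq
  have hq0 : 0 < q := by positivity
  have hq1 : q ≤ 1 := Real.rpow_le_one_of_one_le_of_nonpos hM (by norm_num)
  have hqM : M * q ^ 2 = 1 := by
    rw [hq, ← Real.rpow_natCast, ← Real.rpow_mul hM0.le]
    norm_num
    rw [Real.rpow_neg_one]; field_simp
  set r := a * q with hrdef
  have hr : 0 < r := by positivity
  have hra : r ≤ a := by nlinarith
  have hMr : M * r ^ 2 = a ^ 2 := by
    rw [hrdef]; linear_combination a ^ 2 * hqM
  have hr2 : r ^ 2 ≤ a := by nlinarith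
  refine ⟨r, hr, ?_⟩
  have hI : 1 * r ^ ((n:ℝ) + 2) * M ^ (0:ℝ) ≤ ∫ y in cube n 0 r, gI n hn M 0 r y := by
    refine le_trans (le_of_eq ?_) (I_lower n hn M 0 r 0 (fun _ => - r / 2) r r (r ^ 2) hr.le hr.le ?_)
    · rw [← pow_succ', Nat.sub_add_cancel hn, Real.rpow_add hr]
      simp [mul_comm]
    · intro y hy
      simp only [ite_self] at hy
      refine ⟨?_, gI_lower n hn M 0 r y (-r ^ 2 / 2) (r ^ 2) (by positivity) ?_⟩
      · intro i
        have := hy i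
        simp only [PiLp.zero_apply, abs_le]
        constructor <;> linarith [this.1, this.2]
      · intro s hs
        obtain ⟨s1, s2⟩ := hs
        refine ⟨⟨by rw [Real.rpow_two]; linarith, by rw [Real.rpow_two]; linarith⟩, ?_, ?_, ?_⟩
        · simp only [abs_le]; rw [← hadef]; constructor <;> linarith
        · have := hy ⟨0, hn⟩
          simp only [abs_le]; rw [← hadef]; constructor <;> nlinarith [this.1, this.2]
        · intro i _
          have := hy i
          simp only [abs_le]; rw [← hadef]; constructor <;> linarith [this.1, this.2]
  refine le_trans (le_of_eq ?_) (V_mono _ α p r _ _ hp hr (by positivity) hI)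
  rw [V_eq _ _ _ _ _ _ _ _ zero_le_one hr hM0]
  simp only [Real.one_rpow, sub_self, zero_div, add_zero, Real.rpow_zero, mul_one, one_mul]
  rw [hrdef, Real.mul_rpow ha0.le hq0.le, hq, ← Real.rpow_mul hM0.le]
  congr 2; ring

lemma lower2 (n : ℕ) (hn : 0 < n) (α p : ℝ) (hp : 1 ≤ p) (M : ℝ) (hM : 1 ≤ M) (r : ℝ)
    (hr1 : 1 ≤ r) (hrM : r ≤ M) :
    ((1 / (4 * (n:ℝ))) ^ (n + 1) / 2) ^ (1 / p) * (r ^ (α + (1 - ((n:ℝ) + 2)) / p) * M ^ (-1 / p)) ≤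
      r ^ α * (r ^ (-((n : ℝ) + 2)) * ∫ y in cube n 0 r, gI n hn M 0 r y) ^ (1 / p) := by
  have hM0 : 0 < M := by linarith
  have hr : 0 < r := by linarith
  have hn1 : (1:ℝ) ≤ n := by exact_mod_cast hn
  set a := 1 / (4 * (n:ℝ)) with hadef
  have ha : a ≤ 1 / 4 := by
    apply one_div_le_one_div_of_le <;> linarith
  have ha0 : 0 < a := by positivity
  have hI : (a ^ (n + 1) / 2) * r ^ (1:ℝ) * M ^ (-1:ℝ) ≤ ∫ y in cube n 0 r, gI n hn M 0 r y := by
    refine le_trans (le_of_eq ?_) (I_lower n hn M 0 r 0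
      (fun i => if i = ⟨0, hn⟩ then - (a * r) / 2 else - a / 2) (a * r) a (a / (2 * M))
        (by positivity) (by positivity) ?_)
    · have : a ^ (n + 1) = a * (a * a ^ (n - 1)) := by
        rw [← pow_succ', Nat.sub_add_cancel hn, pow_succ']
      rw [this, Real.rpow_one, Real.rpow_neg_one]
      field_simp
    · intro y hy
      have y0 := hy ⟨0, hn⟩
      simp only [if_true] at y0
      have yi : ∀ i, i ≠ ⟨0, hn⟩ → - a / 2 ≤ y i ∧ y i ≤ - a / 2 + a := by
        intro i hi
        have := hy i
        simpa only [if_neg hi] using this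
      have har : a * r ≤ r := by nlinarith
      refine ⟨?_, gI_lower n hn M 0 r y (y ⟨0, hn⟩ / (2 * M) - a / (2 * M) / 2) (a / (2 * M))
        (by positivity) ?_⟩
      · intro i
        simp only [PiLp.zero_apply, abs_le]
        by_cases hi : i = ⟨0, hn⟩
        · subst hi
          constructor <;> linarith [y0.1, y0.2]
        · have := yi i hi
          constructor <;> linarith [this.1, this.2]
      · intro s hs
        obtain ⟨s1, s2⟩ := hs
        have e1 : y ⟨0, hn⟩ / (2 * M) * (2 * M) = y ⟨0, hn⟩ := by field_simp
        have e2 : a / (2 * M) * (2 * M) = a := by field_simp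
        have s1' := mul_le_mul_of_nonneg_right s1 (by positivity : 0 ≤ 2 * M)
        have s2' := mul_le_mul_of_nonneg_right s2 (by positivity : 0 ≤ 2 * M)
        have t1 : y ⟨0, hn⟩ - a / 2 ≤ s * (2 * M) := by nlinarith
        have t2 : s * (2 * M) ≤ y ⟨0, hn⟩ + a / 2 := by nlinarith
        have harM : a * r ≤ a * M := by nlinarith
        have haM : a ≤ a * M := by nlinarith
        have u1 : - (a / 2) ≤ s := by
          refine le_of_mul_le_mul_right ?_ (by positivity : 0 < 2 * M)
          linarith [y0.1]
        have u2 : s ≤ a / 2 := by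
          refine le_of_mul_le_mul_right ?_ (by positivity : 0 < 2 * M)
          linarith [y0.2]
        have hr2 : 1 ≤ r ^ 2 := by nlinarith
        refine ⟨⟨by rw [Real.rpow_two]; linarith, by rw [Real.rpow_two]; linarith⟩, ?_, ?_, ?_⟩
        · simp only [abs_le]; rw [← hadef]; constructor <;> linarith
        · simp only [abs_le]; rw [← hadef]; constructor <;> linarith
        · intro i hi
          have := yi i hi
          simp only [abs_le]; rw [← hadef]; constructor <;> linarith [this.1, this.2]
  refine le_trans (le_of_eq ?_) (V_mono _ α p r _ _ hp hr (by positivity) hI)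
  rw [V_eq _ _ _ _ _ _ _ _ (by positivity) hr hM0, mul_assoc]

/-- two-sided bound
`‖χ_B‖_{𝔏^{α,p}_2} ∼ max{M^{-α/2}, M^{-1/p}, M^{α-(n+2)/p}}`, uniformly in `M ≥ 1`. -/
theorem indicator_tube_mc_norm (n : ℕ) (hn : 0 < n) (α p : ℝ)
    (hα : 0 < α) (hp : 1 ≤ p) (hp' : p ≤ ((n : ℝ) + 2) / α) :
    ∃ c > 0, ∃ C > 0, ∀ M : ℝ, 1 ≤ M →
      ENNReal.ofReal (c * max (M ^ (-α / 2)) (max (M ^ (-1 / p)) (M ^ (α - ((n : ℝ) + 2) / p)))) ≤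
          MCnorm n 2 α p (fun y s => (tubeB n hn M).indicator (fun _ => (1 : ℝ)) (y, s)) ∧
        MCnorm n 2 α p (fun y s => (tubeB n hn M).indicator (fun _ => (1 : ℝ)) (y, s)) ≤
          ENNReal.ofReal
            (C * max (M ^ (-α / 2)) (max (M ^ (-1 / p)) (M ^ (α - ((n : ℝ) + 2) / p)))) := by
  have hn1 : (1:ℝ) ≤ n := by exact_mod_cast hn
  have hc1 : 0 < (1 / (4 * (n:ℝ))) ^ α := by positivity
  have hc2 : 0 < ((1 / (4 * (n:ℝ))) ^ (n + 1) / 2) ^ (1 / p) := by positivity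
  refine ⟨min ((1 / (4 * (n:ℝ))) ^ α) (((1 / (4 * (n:ℝ))) ^ (n + 1) / 2) ^ (1 / p)),
    lt_min hc1 hc2, 2, by norm_num, fun M hM => ?_⟩
  have hM0 : 0 < M := by linarith
  rw [MC_eq n hn α p M hp]
  constructor
  · have main : ∃ r : ℝ, 0 < r ∧
        min ((1 / (4 * (n:ℝ))) ^ α) (((1 / (4 * (n:ℝ))) ^ (n + 1) / 2) ^ (1 / p)) *
          max (M ^ (-α / 2)) (max (M ^ (-1 / p)) (M ^ (α - ((n : ℝ) + 2) / p))) ≤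
        r ^ α * (r ^ (-((n : ℝ) + 2)) * ∫ y in cube n 0 r, gI n hn M 0 r y) ^ (1 / p) := by
      rcases max_choice (M ^ (-α / 2)) (max (M ^ (-1 / p)) (M ^ (α - ((n : ℝ) + 2) / p))) with h | h
      · rw [h]
        obtain ⟨r, hr, hh⟩ := lower1 n hn α p hp M hM
        exact ⟨r, hr, (mul_le_mul_of_nonneg_right (min_le_left _ _) (by positivity)).trans hh⟩
      · rw [h]
        rcases max_choice (M ^ (-1 / p)) (M ^ (α - ((n : ℝ) + 2) / p)) with h | h
        · rw [h]
          have hh := lower2 n hn α p hp M hM 1 le_rfl hM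
          refine ⟨1, one_pos, le_trans ?_ hh⟩
          rw [Real.one_rpow, one_mul]
          exact mul_le_mul_of_nonneg_right (min_le_right _ _) (by positivity)
        · rw [h]
          have hh := lower2 n hn α p hp M hM M hM le_rfl
          refine ⟨M, hM0, le_trans ?_ hh⟩
          rw [← Real.rpow_add hM0]
          have : α + (1 - ((n:ℝ) + 2)) / p + -1 / p = α - ((n : ℝ) + 2) / p := by ring
          rw [this]
          exact mul_le_mul_of_nonneg_right (min_le_right _ _) (by positivity)
    obtain ⟨r, hr, hh⟩ := main
    exact (ENNReal.ofReal_le_ofReal hh).trans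
      (le_iSup_of_le 0 (le_iSup_of_le 0 (le_iSup_of_le r (le_iSup_of_le hr le_rfl))))
  · exact iSup_le fun x => iSup_le fun t => iSup_le fun r => iSup_le fun hr =>
      ENNReal.ofReal_le_ofReal (upper n hn α p hα hp hp' M hM x t r hr)

end
end
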